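/- arXiv:math/0210189 — 2 statements merged into one kernel-verified Lean document; each statement's English description precedes it below -/
import Mathlib

section
/- (Hopf–Rinow theorem for path metric spaces) If (X,d) is a connected, locally compact, complete path metric space, then any pair of points x,y ∈ X can be joined by a global geodesic, i.e. there is a Lipschitz curve c:[a,b]→X with c(a)=x, c(b)=y and L(c) = d(x,y). -/
open Filter Topology Set

/-- The dilatation (metric derivative) of a map `f` at a point `u`, with the
supremum restricted to pairs of points of `s`. -/
noncomputable def dilatationOn {X : Type*} [MetricSpace X] (f : ℝ → X) (s : Set ℝ) (u : ℝ) : ℝ :=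
  Filter.limsup
    (fun ε : ℝ => sSup ((fun p : ℝ × ℝ => dist (f p.1) (f p.2) / dist p.1 p.2) ''
      {p : ℝ × ℝ | p.1 ∈ s ∧ p.2 ∈ s ∧ p.1 ≠ p.2 ∧ dist p.1 u < ε ∧ dist p.2 u < ε}))
    (nhdsWithin 0 (Set.Ioi 0))

/-- The length of a curve `f : [a,b] → X`, `L(f) = ∫_a^b dil(f)(t) dt`. -/
noncomputable def curveLength {X : Type*} [MetricSpace X] (f : ℝ → X) (a b : ℝ) : ℝ :=
  ∫ t in a..b, dilatationOn f (Set.Icc a b) t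

/-- A metric space is a path metric space if the distance between any two points
is the infimum of lengths of Lipschitz curves joining them. -/
def IsPathMetricSpace (X : Type*) [MetricSpace X] : Prop :=
  ∀ x y : X, dist x y = sInf {L : ℝ | ∃ (a b : ℝ) (f : ℝ → X) (K : NNReal), a ≤ b ∧
    LipschitzOnWith K f (Set.Icc a b) ∧ f a = x ∧ f b = y ∧ L = curveLength f a b}

section Dilatation

variable {X : Type*} [MetricSpace X] {f : ℝ → X} {s : Set ℝ} {K : NNReal} {u c : ℝ}

theorem dilatationOn_sSup_nonneg (f : ℝ → X) (s : Set ℝ) (u ε : ℝ) :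
    0 ≤ sSup ((fun p : ℝ × ℝ => dist (f p.1) (f p.2) / dist p.1 p.2) ''
      {p : ℝ × ℝ | p.1 ∈ s ∧ p.2 ∈ s ∧ p.1 ≠ p.2 ∧ dist p.1 u < ε ∧ dist p.2 u < ε}) := by
  apply Real.sSup_nonneg
  rintro _ ⟨p, -, rfl⟩
  positivity

theorem dilatationOn_le {ε : ℝ} (hc : 0 ≤ c) (hε : 0 < ε)
    (h : ∀ v ∈ s, ∀ w ∈ s, dist v u < ε → dist w u < ε → dist (f v) (f w) ≤ c * dist v w) :
    dilatationOn f s u ≤ c := by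
  refine limsup_le_of_le ?_ ?_
  · exact IsBoundedUnder.isCoboundedUnder_le
      ⟨0, eventually_map.2 (Eventually.of_forall fun ε => dilatationOn_sSup_nonneg f s u ε)⟩
  · filter_upwards [Ioo_mem_nhdsGT hε] with δ hδ
    refine Real.sSup_le ?_ hc
    rintro _ ⟨p, ⟨h1, h2, h3, h4, h5⟩, rfl⟩
    exact div_le_of_le_mul₀ dist_nonneg hc
      (h _ h1 _ h2 (h4.trans hδ.2) (h5.trans hδ.2))

theorem LipschitzOnWith.div_dist_le (hf : LipschitzOnWith K f s) {v w : ℝ} (hv : v ∈ s)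
    (hw : w ∈ s) : dist (f v) (f w) / dist v w ≤ K :=
  div_le_of_le_mul₀ dist_nonneg K.2 (hf.dist_le_mul _ hv _ hw)

theorem LipschitzOnWith.isBoundedUnder_dilatationOn (hf : LipschitzOnWith K f s) (u : ℝ) :
    IsBoundedUnder (· ≤ ·) (𝓝[>] (0 : ℝ)) (fun ε : ℝ =>
      sSup ((fun p : ℝ × ℝ => dist (f p.1) (f p.2) / dist p.1 p.2) ''
        {p : ℝ × ℝ | p.1 ∈ s ∧ p.2 ∈ s ∧ p.1 ≠ p.2 ∧ dist p.1 u < ε ∧ dist p.2 u < ε})) := by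
  refine ⟨K, eventually_map.2 (Eventually.of_forall fun ε => Real.sSup_le ?_ K.2)⟩
  rintro _ ⟨p, ⟨h1, h2, -⟩, rfl⟩
  exact hf.div_dist_le h1 h2

theorem LipschitzOnWith.dilatationOn_nonneg (hf : LipschitzOnWith K f s) (u : ℝ) :
    0 ≤ dilatationOn f s u := by
  refine le_limsup_of_le (hf.isBoundedUnder_dilatationOn u) fun b hb => ?_
  obtain ⟨ε, hε⟩ := hb.exists
  exact (dilatationOn_sSup_nonneg f s u ε).trans hε

theorem LipschitzOnWith.dilatationOn_le (hf : LipschitzOnWith K f s) (u : ℝ) :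
    dilatationOn f s u ≤ K :=
  _root_.dilatationOn_le K.2 one_pos fun v hv w hw _ _ => hf.dist_le_mul v hv w hw

/-- Near `u`, a Lipschitz map is `c`-Lipschitz for any `c` above its dilatation at `u`. -/
theorem LipschitzOnWith.exists_dist_le_of_dilatationOn_lt (hf : LipschitzOnWith K f s)
    (h : dilatationOn f s u < c) :
    ∃ ε > 0, ∀ v ∈ s, ∀ w ∈ s, dist v u < ε → dist w u < ε →
      dist (f v) (f w) ≤ c * dist v w := by
  obtain ⟨ε, hε, hpos⟩ := ((eventually_lt_of_limsup_lt h (hf.isBoundedUnder_dilatationOn u)).and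
    self_mem_nhdsWithin).exists
  refine ⟨ε, hpos, fun v hv w hw hvu hwu => ?_⟩
  rcases eq_or_ne v w with rfl | hvw
  · simp
  rw [← div_le_iff₀ (dist_pos.2 hvw)]
  refine (le_csSup ?_ ?_).trans hε.le
  swap
  · exact ⟨(v, w), ⟨hv, hw, hvw, hvu, hwu⟩, rfl⟩
  refine ⟨K, ?_⟩
  rintro _ ⟨p, ⟨h1, h2, -⟩, rfl⟩
  exact hf.div_dist_le h1 h2

theorem LipschitzOnWith.upperSemicontinuous_dilatationOn (hf : LipschitzOnWith K f s) :
    UpperSemicontinuous (dilatationOn f s) := by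
  intro u c hc
  obtain ⟨c', h1, h2⟩ := exists_between hc
  obtain ⟨ε, hε, H⟩ := hf.exists_dist_le_of_dilatationOn_lt h1
  filter_upwards [Metric.ball_mem_nhds u (half_pos hε)] with v hv
  rw [Metric.mem_ball] at hv
  refine (_root_.dilatationOn_le ((hf.dilatationOn_nonneg u).trans h1.le) (half_pos hε)
    fun p hp q hq hpv hqv => H p hp q hq ?_ ?_).trans_lt h2
  · linarith [dist_triangle p v u]
  · linarith [dist_triangle q v u]

theorem LipschitzOnWith.intervalIntegrable_dilatationOn (hf : LipschitzOnWith K f s) (a b : ℝ) :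
    IntervalIntegrable (dilatationOn f s) MeasureTheory.volume a b := by
  refine (intervalIntegrable_const (c := (K : ℝ))).mono_fun
    hf.upperSemicontinuous_dilatationOn.measurable.aestronglyMeasurable
    (Eventually.of_forall fun u => ?_)
  beta_reduce
  rw [Real.norm_of_nonneg (hf.dilatationOn_nonneg u), Real.norm_of_nonneg K.coe_nonneg]
  exact hf.dilatationOn_le u

theorem LipschitzOnWith.dist_le_integral_dilatationOn {a b p q : ℝ}
    (hf : LipschitzOnWith K f (Icc a b)) (hap : a ≤ p) (hpq : p ≤ q) (hqb : q ≤ b) :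
    dist (f p) (f q) ≤ ∫ t in p..q, dilatationOn f (Icc a b) t := by
  set g : ℝ → ℝ := fun t => dist (f p) (f t) with hg
  have hgf (v w : ℝ) : dist (g v) (g w) ≤ dist (f v) (f w) := by
    rw [Real.dist_eq]
    simpa [hg, dist_comm (f p)] using abs_dist_sub_le (f v) (f w) (f p)
  have hgl : LipschitzOnWith K g (uIcc p q) := by
    rw [uIcc_of_le hpq]
    exact LipschitzOnWith.of_dist_le_mul fun v hv w hw => (hgf v w).trans
      (hf.dist_le_mul _ (Icc_subset_Icc hap hqb hv) _ (Icc_subset_Icc hap hqb hw))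
  have hac := hgl.absolutelyContinuousOnInterval
  have hint := hac.integral_deriv_eq_sub
  have : dist (f p) (f q) = ∫ t in p..q, deriv g t := by rw [hint]; simp [hg]
  rw [this]
  refine intervalIntegral.integral_mono_on_of_le_Ioo hpq hac.intervalIntegrable_deriv
    (hf.intervalIntegrable_dilatationOn p q) fun u hu => le_of_forall_gt fun c hc => ?_
  obtain ⟨c', h1, h2⟩ := exists_between hc
  obtain ⟨ε, hε, H⟩ := hf.exists_dist_le_of_dilatationOn_lt h1
  refine ((le_abs_self _).trans (norm_deriv_le_of_lip' (f := g)
    ((hf.dilatationOn_nonneg u).trans h1.le) ?_)).trans_lt h2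
  have hu' : u ∈ Ioo a b := Ioo_subset_Ioo hap hqb hu
  filter_upwards [Metric.ball_mem_nhds u hε, Icc_mem_nhds hu'.1 hu'.2] with v hv hv'
  rw [← dist_eq_norm, ← dist_eq_norm]
  exact (hgf v u).trans (H v hv' u ⟨hu'.1.le, hu'.2.le⟩ hv (by simpa using hε))

/-- A curve parametrised by arc length on `[0, D]` has length `D`. -/
theorem curveLength_of_isometryOn {D : ℝ} (hD : 0 ≤ D)
    (hf : ∀ p ∈ Icc 0 D, ∀ q ∈ Icc 0 D, dist (f p) (f q) = dist p q) :
    curveLength f 0 D = D := by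
  have hl : LipschitzOnWith 1 f (Icc 0 D) :=
    LipschitzOnWith.of_dist_le_mul fun p hp q hq => by simp [hf p hp q hq]
  refine le_antisymm ?_ ?_
  · calc curveLength f 0 D ≤ ∫ _ in (0 : ℝ)..D, (1 : ℝ) :=
        intervalIntegral.integral_mono_on hD (hl.intervalIntegrable_dilatationOn 0 D)
          intervalIntegrable_const fun u _ => by simpa using hl.dilatationOn_le u
      _ = D := by simp
  · calc D = dist (f 0) (f D) := by
          rw [hf 0 ⟨le_rfl, hD⟩ D ⟨hD, le_rfl⟩, dist_comm, Real.dist_0_eq_abs, abs_of_nonneg hD]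
      _ ≤ curveLength f 0 D := hl.dist_le_integral_dilatationOn le_rfl hD le_rfl

end Dilatation

section Length

variable {X : Type*} [MetricSpace X]

theorem IsPathMetricSpace.exists_dist_le_add (hX : IsPathMetricSpace X) (x y : X) {r ε : ℝ}
    (hr : 0 ≤ r) (hr' : r ≤ dist x y) (hε : 0 < ε) :
    ∃ z, dist x z ≤ r ∧ dist z y ≤ dist x y - r + ε := by
  have hxy := hX x y
  set S := {L : ℝ | ∃ (a b : ℝ) (f : ℝ → X) (K : NNReal), a ≤ b ∧
    LipschitzOnWith K f (Set.Icc a b) ∧ f a = x ∧ f b = y ∧ L = curveLength f a b}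
  rcases S.eq_empty_or_nonempty with hS | hS
  · rw [hS, Real.sInf_empty] at hxy
    exact ⟨x, by simpa using hr, by linarith⟩
  obtain ⟨L, ⟨a, b, f, K, hab, hf, rfl, rfl, rfl⟩, hL⟩ :=
    exists_lt_of_csInf_lt hS (hxy ▸ lt_add_of_pos_right (dist x y) hε)
  have hcont : ContinuousOn (fun t => dist (f a) (f t)) (Icc a b) :=
    (continuous_const.dist continuous_id).comp_continuousOn hf.continuousOn
  obtain ⟨t, ht, htr⟩ := intermediate_value_Icc hab hcont
    (show r ∈ Icc (dist (f a) (f a)) (dist (f a) (f b)) from ⟨by simpa using hr, hr'⟩)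
  have h1 := hf.dist_le_integral_dilatationOn le_rfl ht.1 ht.2
  have h2 := hf.dist_le_integral_dilatationOn ht.1 ht.2 le_rfl
  have h3 := intervalIntegral.integral_add_adjacent_intervals
    (hf.intervalIntegrable_dilatationOn a t) (hf.intervalIntegrable_dilatationOn t b)
  simp only [curveLength] at hL
  simp only at htr
  exact ⟨f t, htr.le, by linarith⟩

/-- A complete locally compact path metric space is proper. -/
theorem IsPathMetricSpace.properSpace [CompleteSpace X] [LocallyCompactSpace X]
    (hX : IsPathMetricSpace X) : ProperSpace X := by
  refine ⟨fun x r₀ => ?_⟩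
  by_contra hr₀
  set A := {r : ℝ | 0 ≤ r ∧ IsCompact (Metric.closedBall x r)}
  have mono {r r' : ℝ} (h : IsCompact (Metric.closedBall x r')) (hr : r ≤ r') :
      IsCompact (Metric.closedBall x r) :=
    h.of_isClosed_subset Metric.isClosed_closedBall (Metric.closedBall_subset_closedBall hr)
  have hbdd : BddAbove A := ⟨r₀, fun r hr => le_of_not_ge fun h => hr₀ (mono hr.2 h)⟩
  have h0 : (0 : ℝ) ∈ A := ⟨le_rfl, by simp⟩
  set R := sSup A
  have hR : 0 ≤ R := le_csSup hbdd h0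
  have hlt {r : ℝ} (hr : r < R) : IsCompact (Metric.closedBall x r) := by
    obtain ⟨r', hr', h⟩ := exists_lt_of_lt_csSup ⟨0, h0⟩ hr
    exact mono hr'.2 h.le
  have hRc : IsCompact (Metric.closedBall x R) := by
    refine isCompact_iff_totallyBounded_isComplete.2 ⟨?_, Metric.isClosed_closedBall.isComplete⟩
    refine Metric.totallyBounded_iff.2 fun ε hε => ?_
    have hK : IsCompact (Metric.closedBall x (max (R - ε / 4) 0)) := by
      rcases max_cases (R - ε / 4) 0 with h | h <;> rw [h.1]
      · exact hlt (by linarith)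
      · exact h0.2
    obtain ⟨t, ht, hcov⟩ := Metric.totallyBounded_iff.1 hK.totallyBounded (ε / 2) (by linarith)
    refine ⟨t, ht, fun p hp => ?_⟩
    rw [Metric.mem_closedBall, dist_comm] at hp
    obtain ⟨z, hz, hzp⟩ := hX.exists_dist_le_add x p (r := min (max (R - ε / 4) 0) (dist x p))
      (by positivity) (min_le_right _ _) (show 0 < ε / 8 by linarith)
    have hzK : z ∈ Metric.closedBall x (max (R - ε / 4) 0) := by
      rw [Metric.mem_closedBall, dist_comm]
      exact hz.trans (min_le_left _ _)
    obtain ⟨y, hy, hzy⟩ := mem_iUnion₂.1 (hcov hzK)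
    refine mem_iUnion₂.2 ⟨y, hy, ?_⟩
    rw [Metric.mem_ball] at hzy ⊢
    have : dist x p - ε / 4 ≤ min (max (R - ε / 4) 0) (dist x p) :=
      le_min (le_max_of_le_left (by linarith)) (by linarith)
    linarith [dist_triangle p z y, dist_comm p z]
  obtain ⟨δ, hδ, hδc⟩ := hRc.exists_isCompact_cthickening
  have hmem : R + δ / 2 ∈ A := by
    refine ⟨by linarith, hδc.of_isClosed_subset Metric.isClosed_closedBall fun p hp => ?_⟩
    rw [Metric.mem_closedBall, dist_comm] at hp
    obtain ⟨z, hz, hzp⟩ := hX.exists_dist_le_add x p (r := min R (dist x p))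
      (by positivity) (min_le_right _ _) (half_pos hδ)
    refine Metric.mem_cthickening_of_dist_le p z δ _ ?_ ?_
    · rw [Metric.mem_closedBall, dist_comm]
      exact hz.trans (min_le_left _ _)
    · have : dist x p - δ / 2 ≤ min R (dist x p) := le_min (by linarith) (by linarith)
      linarith [dist_comm p z]
  linarith [le_csSup hbdd hmem]

theorem IsPathMetricSpace.exists_dist_eq [ProperSpace X] (hX : IsPathMetricSpace X) (x y : X)
    {r : ℝ} (hr : 0 ≤ r) (hr' : r ≤ dist x y) :
    ∃ z, dist x z = r ∧ dist z y = dist x y - r := by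
  obtain ⟨z, hz, hmin⟩ := (isCompact_closedBall x r).exists_isMinOn
    ⟨x, Metric.mem_closedBall_self hr⟩
    (continuous_id.dist (continuous_const (y := y))).continuousOn
  rw [Metric.mem_closedBall, dist_comm] at hz
  have hzy : dist z y ≤ dist x y - r := by
    refine le_of_forall_pos_le_add fun ε hε => ?_
    obtain ⟨w, hw, hwy⟩ := hX.exists_dist_le_add x y hr hr' hε
    have hwK : w ∈ Metric.closedBall x r := by rwa [Metric.mem_closedBall, dist_comm]
    exact (hmin hwK).trans hwy
  have := dist_triangle x z y
  exact ⟨z, by linarith, by linarith⟩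

/-- If exact intermediate points exist, then any two points are joined by an isometrically
embedded segment. -/
theorem exists_isometryOn_of_exists_dist_eq [CompleteSpace X]
    (H : ∀ (x y : X) (r : ℝ), 0 ≤ r → r ≤ dist x y → ∃ z, dist x z = r ∧ dist z y = dist x y - r)
    (x y : X) :
    ∃ c : ℝ → X, c 0 = x ∧ c (dist x y) = y ∧
      ∀ p ∈ Icc 0 (dist x y), ∀ q ∈ Icc 0 (dist x y), dist (c p) (c q) = dist p q := by
  set D := dist x y with hD
  set P : Set (Set X) := {S | ∀ p ∈ S, ∀ q ∈ S, dist p q = dist (dist x p) (dist x q)}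
  have hxyP : ({x, y} : Set X) ∈ P := by
    rintro p (rfl | rfl) q (rfl | rfl) <;> simp [dist_comm]
  obtain ⟨S, hS, hmax⟩ := zorn_subset_nonempty P (fun C hC hch hne => by
    refine ⟨⋃₀ C, ?_, fun s hs => subset_sUnion_of_mem hs⟩
    rintro p ⟨s, hs, hp⟩ q ⟨t, ht, hq⟩
    rcases hch.total hs ht with h | h
    · exact hC ht p (h hp) q hq
    · exact hC hs p hp q (h hq)) _ hxyP
  have hSP : ∀ p ∈ S, ∀ q ∈ S, dist p q = dist (dist x p) (dist x q) := hmax.prop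
  have hxS : x ∈ S := hS (by simp)
  have hyS : y ∈ S := hS (by simp)
  have hScl : IsClosed S := by
    have hcl : closure S ∈ P := by
      intro p hp q hq
      have hc : IsClosed {z : X × X | dist z.1 z.2 = dist (dist x z.1) (dist x z.2)} :=
        isClosed_eq (by fun_prop) (by fun_prop)
      have hsub : S ×ˢ S ⊆ {z : X × X | dist z.1 z.2 = dist (dist x z.1) (dist x z.2)} :=
        fun z hz => hSP _ hz.1 _ hz.2
      have := hc.closure_subset_iff.2 hsub
      rw [closure_prod_eq] at this
      exact this (mk_mem_prod hp hq)
    exact closure_subset_iff_isClosed.1 (hmax.le_of_ge hcl subset_closure)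
  have hT : IsClosed (dist x '' S) := by
    have hiso : Isometry (S.domRestrict (dist x)) :=
      Isometry.of_dist_eq fun p q => (hSP p p.2 q q.2).symm
    have := hScl.completeSpace_coe
    rw [← range_domRestrict]
    exact hiso.isClosedEmbedding.isClosed_range
  have hsurj : ∀ t ∈ Icc 0 D, ∃ p ∈ S, dist x p = t := by
    intro t ht
    by_contra! hne
    have hC1 : IsCompact (dist x '' S ∩ Icc 0 t) := isCompact_Icc.inter_left hT
    have hC2 : IsCompact (dist x '' S ∩ Icc t D) := isCompact_Icc.inter_left hT
    obtain ⟨_, ⟨⟨p, hp, rfl⟩, hpt⟩, hpmax⟩ :=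
      hC1.exists_isGreatest ⟨0, ⟨x, hxS, dist_self x⟩, le_rfl, ht.1⟩
    obtain ⟨_, ⟨⟨q, hq, rfl⟩, hqt⟩, hqmin⟩ :=
      hC2.exists_isLeast ⟨D, ⟨y, hyS, rfl⟩, ht.2, le_rfl⟩
    have hpq := hSP p hp q hq
    rw [Real.dist_eq, abs_of_nonpos (by linarith [hpt.2, hqt.1])] at hpq
    obtain ⟨z, hz1, hz2⟩ := H p q (t - dist x p) (by linarith [hpt.2]) (by linarith [hqt.1])
    have hxz : dist x z = t := by
      linarith [dist_triangle x p z, dist_triangle x z q]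
    have key : ∀ w ∈ S, dist z w = dist (dist x z) (dist x w) := by
      intro w hw
      have hle := abs_dist_sub_le z w x
      rw [dist_comm z x, dist_comm w x] at hle
      refine le_antisymm ?_ (by rwa [Real.dist_eq])
      rcases le_total (dist x w) t with h | h
      · have hwp : dist x w ≤ dist x p := hpmax ⟨⟨w, hw, rfl⟩, dist_nonneg, h⟩
        have h1 := hSP p hp w hw
        rw [Real.dist_eq, abs_of_nonneg (by linarith)] at h1
        rw [hxz, Real.dist_eq, abs_of_nonneg (by linarith)]
        linarith [dist_triangle z p w, dist_comm z p]
      · have hwq : dist x q ≤ dist x w := by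
          rcases le_total (dist x w) D with h' | h'
          · exact hqmin ⟨⟨w, hw, rfl⟩, h, h'⟩
          · exact hqt.2.trans h'
        have h1 := hSP q hq w hw
        rw [Real.dist_eq, abs_of_nonpos (by linarith)] at h1
        rw [hxz, Real.dist_eq, abs_of_nonpos (by linarith)]
        linarith [dist_triangle z q w]
    have hins : insert z S ∈ P := by
      rintro v (rfl | hv) w (rfl | hw)
      · simp
      · exact key w hw
      · rw [dist_comm, key v hv, dist_comm]
      · exact hSP v hv w hw
    exact hne z (hmax.le_of_ge hins (subset_insert z S) (mem_insert z S)) hxz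
  have : Nonempty X := ⟨x⟩
  choose! c hcS hc using hsurj
  have hD0 : 0 ≤ D := dist_nonneg
  have h0 : (0 : ℝ) ∈ Icc 0 D := ⟨le_rfl, hD0⟩
  have h1 : D ∈ Icc 0 D := ⟨hD0, le_rfl⟩
  refine ⟨c, (dist_eq_zero.1 (hc 0 h0)).symm, ?_, fun p hp q hq => ?_⟩
  · rw [← dist_eq_zero, hSP _ (hcS D h1) _ hyS, hc D h1, ← hD, dist_self]
  · rw [hSP _ (hcS p hp) _ (hcS q hq), hc p hp, hc q hq]

end Length

/-- Hopf–Rinow theorem for path metric spaces: in a connected, locally compact,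
complete path metric space, any two points can be joined by a global geodesic,
i.e. a Lipschitz curve whose length equals the distance between the endpoints. -/
theorem hopf_rinow (X : Type*) [MetricSpace X] [CompleteSpace X] [LocallyCompactSpace X]
    [ConnectedSpace X] (hX : IsPathMetricSpace X) (x y : X) :
    ∃ (a b : ℝ) (c : ℝ → X) (K : NNReal), a ≤ b ∧ LipschitzOnWith K c (Set.Icc a b) ∧
      c a = x ∧ c b = y ∧ curveLength c a b = dist x y := by
  have := hX.properSpace
  obtain ⟨c, h0, h1, hc⟩ :=
    exists_isometryOn_of_exists_dist_eq (fun x y r => hX.exists_dist_eq x y) x y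
  exact ⟨0, dist x y, c, 1, dist_nonneg,
    LipschitzOnWith.of_dist_le_mul fun p hp q hq => by simp [hc p hp q hq],
    h0, h1, curveLength_of_isometryOn dist_nonneg hc⟩
end

section
/- (Pansu–Rademacher theorem for the Heisenberg group) Let n ≥ 1 and let f: H(n) → H(n) be Lipschitz with respect to the Carnot–Carathéodory distance d_CC. Then f is Pansu differentiable at almost every point of ℝ^{2n+1} with respect to Lebesgue measure. -/
open Filter Topology Set MeasureTheory

noncomputable section

/-- The underlying space `ℝ^{2n}` of the horizontal part of the Heisenberg group. -/
abbrev Epl (n : ℕ) := EuclideanSpace ℝ (Fin (2 * n))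

def idxA {n : ℕ} (i : Fin n) : Fin (2 * n) := ⟨i, by have := i.isLt; omega⟩
def idxB {n : ℕ} (i : Fin n) : Fin (2 * n) := ⟨n + i, by have := i.isLt; omega⟩

/-- The standard symplectic form on `ℝ^{2n}`:
`ω(x,y) = Σ_i (x_i y_{n+i} - x_{n+i} y_i)`. -/
def omegaForm {n : ℕ} (x y : Epl n) : ℝ :=
  ∑ i : Fin n, (x (idxA i) * y (idxB i) - x (idxB i) * y (idxA i))

/-- A point of the Heisenberg group `H(n) = ℝ^{2n} × ℝ`. -/
abbrev Hpt (n : ℕ) := Epl n × ℝ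

/-- Heisenberg group multiplication `(x,x̄)·(y,ȳ) = (x+y, x̄+ȳ+½ω(x,y))`. -/
def hMul {n : ℕ} (p q : Hpt n) : Hpt n :=
  (p.1 + q.1, p.2 + q.2 + (1 / 2) * omegaForm p.1 q.1)

/-- Heisenberg group inverse. -/
def hInv {n : ℕ} (p : Hpt n) : Hpt n := (-p.1, -p.2)

/-- Heisenberg dilatation `δ_ε(x,x̄) = (εx, ε²x̄)`. -/
def hDil {n : ℕ} (ε : ℝ) (p : Hpt n) : Hpt n := (ε • p.1, ε ^ 2 * p.2)

/-- `γ'` is an a.e. derivative of the horizontal Lipschitz curve `(γ, γb)` on `[0,1]`: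
a.e. `γ` has derivative `γ' t` and `γb` has derivative `½ ω(γ t, γ' t)`. -/
def IsHorizontalLift {n : ℕ} (γ : ℝ → Epl n) (γb : ℝ → ℝ) (γ' : ℝ → Epl n) : Prop :=
  ∀ᵐ t ∂(volume.restrict (Set.Icc (0 : ℝ) 1)),
    HasDerivAt γ (γ' t) t ∧ HasDerivAt γb ((1 / 2) * omegaForm (γ t) (γ' t)) t

/-- The Carnot–Carathéodory distance on the Heisenberg group `H(n)`:
the infimum of `∫₀¹ ‖γ'(t)‖ dt` over horizontal Lipschitz curves joining the points. -/
def ccDist (n : ℕ) (p q : Hpt n) : ℝ :=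
  sInf {L : ℝ | ∃ (γ : ℝ → Epl n) (γb : ℝ → ℝ) (γ' : ℝ → Epl n) (K : NNReal),
    LipschitzOnWith K (fun t => ((γ t, γb t) : Hpt n)) (Set.Icc 0 1) ∧
    (γ 0, γb 0) = p ∧ (γ 1, γb 1) = q ∧ IsHorizontalLift γ γb γ' ∧
    L = ∫ t in (0 : ℝ)..1, ‖γ' t‖}

/-- A map between Heisenberg groups is Pansu linear if it is a group morphism
commuting with all dilatations. -/
def IsPansuLinear (n : ℕ) (F : Hpt n → Hpt n) : Prop :=
  (∀ p q : Hpt n, F (hMul p q) = hMul (F p) (F q)) ∧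
  ∀ ε : ℝ, 0 < ε → ∀ p : Hpt n, F (hDil ε p) = hDil ε (F p)

/-- Pansu differentiability of `f : H(n) → H(n)` at `p`: the rescaled finite
difference maps `q ↦ δ_ε⁻¹ (f(p)⁻¹ · f(p · δ_ε q))` converge, uniformly on the
CC unit ball, to a Pansu linear map. -/
def PansuDifferentiableAt (n : ℕ) (f : Hpt n → Hpt n) (p : Hpt n) : Prop :=
  ∃ Df : Hpt n → Hpt n, IsPansuLinear n Df ∧
    ∀ δ : ℝ, 0 < δ → ∃ ε₀ : ℝ, 0 < ε₀ ∧ ∀ ε : ℝ, 0 < ε → ε < ε₀ →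
      ∀ q : Hpt n, ccDist n (0, 0) q ≤ 1 →
        ccDist n (hDil ε⁻¹ (hMul (hInv (f p)) (f (hMul p (hDil ε q))))) (Df q) ≤ δ

section Symplectic

variable {n : ℕ}

theorem omegaForm_add_left (x y z : Epl n) :
    omegaForm (x + y) z = omegaForm x z + omegaForm y z := by
  simp only [omegaForm, PiLp.add_apply, ← Finset.sum_add_distrib]
  exact Finset.sum_congr rfl fun i _ => by ring

theorem omegaForm_smul_left (c : ℝ) (x y : Epl n) :
    omegaForm (c • x) y = c * omegaForm x y := by
  simp only [omegaForm, PiLp.smul_apply, smul_eq_mul, Finset.mul_sum]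
  exact Finset.sum_congr rfl fun i _ => by ring

theorem omegaForm_swap (x y : Epl n) : omegaForm x y = -omegaForm y x := by
  simp only [omegaForm, ← Finset.sum_neg_distrib]
  exact Finset.sum_congr rfl fun i _ => by ring

theorem omegaForm_add_right (x y z : Epl n) :
    omegaForm x (y + z) = omegaForm x y + omegaForm x z := by
  rw [omegaForm_swap, omegaForm_add_left, omegaForm_swap x y, omegaForm_swap x z]
  ring

theorem omegaForm_smul_right (c : ℝ) (x y : Epl n) :
    omegaForm x (c • y) = c * omegaForm x y := by
  rw [omegaForm_swap, omegaForm_smul_left, omegaForm_swap x y]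
  ring

theorem omegaForm_neg_left (x y : Epl n) : omegaForm (-x) y = -omegaForm x y := by
  rw [← neg_one_smul ℝ x, omegaForm_smul_left, neg_one_mul]

theorem omegaForm_neg_right (x y : Epl n) : omegaForm x (-y) = -omegaForm x y := by
  rw [← neg_one_smul ℝ y, omegaForm_smul_right, neg_one_mul]

theorem omegaForm_sub_left (x y z : Epl n) :
    omegaForm (x - y) z = omegaForm x z - omegaForm y z := by
  rw [sub_eq_add_neg, omegaForm_add_left, omegaForm_neg_left, sub_eq_add_neg]

theorem omegaForm_sub_right (x y z : Epl n) :
    omegaForm x (y - z) = omegaForm x y - omegaForm x z := by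
  rw [sub_eq_add_neg, omegaForm_add_right, omegaForm_neg_right, sub_eq_add_neg]

@[simp]
theorem omegaForm_self (x : Epl n) : omegaForm x x = 0 := by
  have := omegaForm_swap x x
  linarith

@[simp]
theorem omegaForm_zero_left (x : Epl n) : omegaForm 0 x = 0 := by
  simp [omegaForm]

@[simp]
theorem omegaForm_zero_right (x : Epl n) : omegaForm x 0 = 0 := by
  simp [omegaForm]

theorem sum_fin_two_mul (h : Fin (2 * n) → ℝ) :
    ∑ j, h j = ∑ i : Fin n, h (idxA i) + ∑ i : Fin n, h (idxB i) := by
  rw [← (finCongr (two_mul n)).symm.sum_comp h, Fin.sum_univ_add]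
  rfl

theorem abs_omegaForm_le (x y : Epl n) : |omegaForm x y| ≤ ‖x‖ * ‖y‖ := by
  have hcs := Finset.sum_mul_sq_le_sq_mul_sq (Finset.univ : Finset (Fin n ⊕ Fin n))
    (Sum.elim (fun i => x (idxA i)) fun i => -x (idxB i))
    (Sum.elim (fun i => y (idxB i)) fun i => y (idxA i))
  simp only [Fintype.sum_sum_type, Sum.elim_inl, Sum.elim_inr, neg_mul, neg_sq,
    Finset.sum_neg_distrib] at hcs
  refine abs_le_of_sq_le_sq ?_ (by positivity)
  rw [mul_pow, EuclideanSpace.norm_sq_eq, EuclideanSpace.norm_sq_eq, sum_fin_two_mul,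
    sum_fin_two_mul, omegaForm, Finset.sum_sub_distrib]
  simp only [Real.norm_eq_abs, sq_abs]
  linarith

/-- The symplectic form as a continuous linear functional of its second argument. -/
def omegaCLM (x : Epl n) : Epl n →L[ℝ] ℝ :=
  LinearMap.toContinuousLinearMap
    { toFun := omegaForm x
      map_add' := omegaForm_add_right x
      map_smul' := fun c y => omegaForm_smul_right c x y }

@[simp]
theorem omegaCLM_apply (x y : Epl n) : omegaCLM x y = omegaForm x y := rfl

theorem continuous_omegaForm : Continuous fun p : Epl n × Epl n => omegaForm p.1 p.2 := by
  unfold omegaForm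
  fun_prop

end Symplectic

section Group

variable {n : ℕ}

theorem hMul_assoc (p q r : Hpt n) : hMul (hMul p q) r = hMul p (hMul q r) := by
  refine Prod.ext (add_assoc _ _ _) ?_
  simp only [hMul, omegaForm_add_left, omegaForm_add_right]
  ring

@[simp]
theorem hMul_zero (p : Hpt n) : hMul p 0 = p := by
  simp [hMul]

@[simp]
theorem zero_hMul (p : Hpt n) : hMul 0 p = p := by
  simp [hMul]

@[simp]
theorem hInv_hMul_self (p : Hpt n) : hMul (hInv p) p = 0 := by
  simp [hMul, hInv, omegaForm_neg_left]

@[simp]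
theorem hMul_hInv_self (p : Hpt n) : hMul p (hInv p) = 0 := by
  simp [hMul, hInv, omegaForm_neg_right]

@[simp]
theorem hInv_hMul_cancel_left (p q : Hpt n) : hMul (hInv p) (hMul p q) = q := by
  rw [← hMul_assoc, hInv_hMul_self, zero_hMul]

@[simp]
theorem hMul_hInv_cancel_left (p q : Hpt n) : hMul p (hMul (hInv p) q) = q := by
  rw [← hMul_assoc, hMul_hInv_self, zero_hMul]

@[simp]
theorem hInv_hInv (p : Hpt n) : hInv (hInv p) = p := by
  simp [hInv]

theorem hInv_hMul (p q : Hpt n) : hInv (hMul p q) = hMul (hInv q) (hInv p) := by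
  refine Prod.ext (by simp [hInv, hMul, add_comm]) ?_
  simp only [hInv, hMul, omegaForm_neg_left, omegaForm_neg_right, omegaForm_swap q.1 p.1]
  ring

theorem hDil_hMul (ε : ℝ) (p q : Hpt n) : hDil ε (hMul p q) = hMul (hDil ε p) (hDil ε q) := by
  refine Prod.ext (smul_add _ _ _) ?_
  simp only [hDil, hMul, omegaForm_smul_left, omegaForm_smul_right]
  ring

theorem hDil_hInv (ε : ℝ) (p : Hpt n) : hDil ε (hInv p) = hInv (hDil ε p) := by
  simp [hDil, hInv]

@[simp]
theorem hDil_apply_zero (ε : ℝ) : hDil ε (0 : Hpt n) = 0 := by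
  simp [hDil]

/-- The horizontal element `(v, 0)`. -/
def hor (v : Epl n) : Hpt n := (v, 0)

theorem hMul_hor (p : Hpt n) (v : Epl n) :
    hMul p (hor v) = (p.1 + v, p.2 + (1 / 2) * omegaForm p.1 v) := by
  simp [hMul, hor]

theorem hor_hMul_hor_smul (s t : ℝ) (v : Epl n) :
    hMul (hor (s • v)) (hor (t • v)) = hor ((s + t) • v) := by
  simp [hor, hMul, omegaForm_smul_left, omegaForm_smul_right, add_smul]

theorem hMul_hor_hMul_hor (p : Hpt n) (s t : ℝ) (v : Epl n) :
    hMul (hMul p (hor (s • v))) (hor (t • v)) = hMul p (hor ((s + t) • v)) := by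
  rw [hMul_assoc, hor_hMul_hor_smul]

end Group

section Gauge

variable {n : ℕ}

/-- A homogeneous norm on the Heisenberg group. -/
def hGauge (p : Hpt n) : ℝ := max ‖p.1‖ (√|p.2|)

theorem hGauge_le_iff {p : Hpt n} {r : ℝ} (hr : 0 ≤ r) :
    hGauge p ≤ r ↔ ‖p.1‖ ≤ r ∧ |p.2| ≤ r ^ 2 := by
  rw [hGauge, max_le_iff, Real.sqrt_le_left hr]

theorem hGauge_nonneg (p : Hpt n) : 0 ≤ hGauge p :=
  (norm_nonneg _).trans (le_max_left _ _)

theorem norm_fst_le_hGauge (p : Hpt n) : ‖p.1‖ ≤ hGauge p := le_max_left _ _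

theorem abs_snd_le_hGauge_sq (p : Hpt n) : |p.2| ≤ hGauge p ^ 2 :=
  ((hGauge_le_iff (hGauge_nonneg p)).1 le_rfl).2

@[simp]
theorem hGauge_zero : hGauge (0 : Hpt n) = 0 := by
  simp [hGauge]

@[simp]
theorem hGauge_hInv (p : Hpt n) : hGauge (hInv p) = hGauge p := by
  simp [hGauge, hInv]

theorem hGauge_hor (v : Epl n) : hGauge (hor v) = ‖v‖ := by
  simp [hGauge, hor]

theorem hGauge_hMul_le (p q : Hpt n) : hGauge (hMul p q) ≤ hGauge p + hGauge q := by
  have hp := hGauge_nonneg p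
  have hq := hGauge_nonneg q
  refine (hGauge_le_iff (by positivity)).2 ⟨?_, ?_⟩
  · exact (norm_add_le _ _).trans (add_le_add (norm_fst_le_hGauge p) (norm_fst_le_hGauge q))
  · have h1 := abs_snd_le_hGauge_sq p
    have h2 := abs_snd_le_hGauge_sq q
    have h3 : |omegaForm p.1 q.1| ≤ hGauge p * hGauge q :=
      (abs_omegaForm_le _ _).trans
        (mul_le_mul (norm_fst_le_hGauge p) (norm_fst_le_hGauge q) (norm_nonneg _) hp)
    have h4 : |(1 / 2) * omegaForm p.1 q.1| ≤ (1 / 2) * (hGauge p * hGauge q) := by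
      rw [abs_mul, abs_of_pos (by norm_num : (0 : ℝ) < 1 / 2)]
      linarith
    have h5 := abs_add_three p.2 q.2 ((1 / 2) * omegaForm p.1 q.1)
    simp only [hMul]
    nlinarith [mul_nonneg hp hq]

theorem hGauge_hDil {ε : ℝ} (hε : 0 ≤ ε) (p : Hpt n) : hGauge (hDil ε p) = ε * hGauge p := by
  simp only [hGauge, hDil, norm_smul, abs_mul, Real.norm_eq_abs, abs_of_nonneg hε]
  rw [Real.sqrt_mul (abs_nonneg _), abs_of_nonneg (sq_nonneg ε), Real.sqrt_sq hε,
    mul_max_of_nonneg _ _ hε]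

/-- The left-invariant homogeneous distance associated with `hGauge`. -/
def hDist (p q : Hpt n) : ℝ := hGauge (hMul (hInv p) q)

@[simp]
theorem hDist_self (p : Hpt n) : hDist p p = 0 := by
  simp [hDist]

theorem hDist_comm (p q : Hpt n) : hDist p q = hDist q p := by
  rw [hDist, ← hGauge_hInv, hInv_hMul, hInv_hInv, hDist]

theorem hDist_triangle (p q r : Hpt n) : hDist p r ≤ hDist p q + hDist q r := by
  have h : hMul (hInv p) r = hMul (hMul (hInv p) q) (hMul (hInv q) r) := by
    rw [hMul_assoc, hMul_hInv_cancel_left]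
  rw [hDist, h]
  exact hGauge_hMul_le _ _

theorem hDist_hMul_left (a p q : Hpt n) : hDist (hMul a p) (hMul a q) = hDist p q := by
  rw [hDist, hDist, hInv_hMul, hMul_assoc, hInv_hMul_cancel_left]

theorem hDist_self_hMul (p q : Hpt n) : hDist p (hMul p q) = hGauge q := by
  rw [hDist, hInv_hMul_cancel_left]

theorem hDist_hDil {ε : ℝ} (hε : 0 ≤ ε) (p q : Hpt n) :
    hDist (hDil ε p) (hDil ε q) = ε * hDist p q := by
  rw [hDist, hDist, ← hDil_hInv, ← hDil_hMul, hGauge_hDil hε]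

theorem hInv_hMul_snd (p q : Hpt n) :
    (hMul (hInv p) q).2 = q.2 - p.2 - (1 / 2) * omegaForm p.1 q.1 := by
  simp only [hMul, hInv, omegaForm_neg_left]
  ring

theorem hInv_hMul_fst (p q : Hpt n) : (hMul (hInv p) q).1 = q.1 - p.1 := by
  simp only [hMul, hInv]
  abel

theorem norm_fst_sub_le_hDist (p q : Hpt n) : ‖q.1 - p.1‖ ≤ hDist p q := by
  rw [← hInv_hMul_fst]
  exact norm_fst_le_hGauge _

theorem abs_snd_sub_le_hDist_sq (p q : Hpt n) :
    |q.2 - p.2 - (1 / 2) * omegaForm p.1 q.1| ≤ hDist p q ^ 2 := by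
  rw [← hInv_hMul_snd]
  exact abs_snd_le_hGauge_sq _

end Gauge

section CarnotCaratheodory

variable {n : ℕ}

theorem exists_omegaForm_single_eq_one (hn : 1 ≤ n) :
    ∃ i j : Fin (2 * n), omegaForm (EuclideanSpace.single i 1) (EuclideanSpace.single j 1) = 1 := by
  let i₀ : Fin n := ⟨0, hn⟩
  refine ⟨idxA i₀, idxB i₀, ?_⟩
  have hAB : ∀ i j : Fin n, idxA i ≠ idxB j := fun i j h => by
    have := congrArg Fin.val h
    have := i.isLt
    simp only [idxA, idxB] at *
    omega
  have hA : ∀ i : Fin n, idxA i = idxA i₀ ↔ i = i₀ := fun i => by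
    simp [idxA, Fin.ext_iff]
  have hB : ∀ i : Fin n, idxB i = idxB i₀ ↔ i = i₀ := fun i => by
    simp [idxB, Fin.ext_iff]
  simp [omegaForm, PiLp.single_apply, hA, hB, hAB, (hAB _ _).symm]

theorem exists_omegaForm_eq_one (hn : 1 ≤ n) :
    ∃ e e' : Epl n, ‖e‖ = 1 ∧ ‖e'‖ = 1 ∧ omegaForm e e' = 1 := by
  obtain ⟨i, j, hij⟩ := exists_omegaForm_single_eq_one hn
  exact ⟨_, _, by simp, by simp, hij⟩

theorem exists_mul_eq_and_abs_le (t : ℝ) : ∃ a b : ℝ, a * b = t ∧ |a| ≤ √|t| ∧ |b| ≤ √|t| := by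
  rcases le_total 0 t with h | h
  · refine ⟨√|t|, √|t|, ?_, ?_, ?_⟩
    · rw [Real.mul_self_sqrt (abs_nonneg _), abs_of_nonneg h]
    all_goals rw [abs_of_nonneg (Real.sqrt_nonneg _)]
  · refine ⟨√|t|, -√|t|, ?_, ?_, ?_⟩
    · rw [mul_neg, Real.mul_self_sqrt (abs_nonneg _), abs_of_nonpos h, neg_neg]
    · rw [abs_of_nonneg (Real.sqrt_nonneg _)]
    · rw [abs_neg, abs_of_nonneg (Real.sqrt_nonneg _)]

/-- The lengths of the horizontal Lipschitz curves joining two points. -/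
def ccLengths (n : ℕ) (p q : Hpt n) : Set ℝ :=
  {L : ℝ | ∃ (γ : ℝ → Epl n) (γb : ℝ → ℝ) (γ' : ℝ → Epl n) (K : NNReal),
    LipschitzOnWith K (fun t => ((γ t, γb t) : Hpt n)) (Set.Icc 0 1) ∧
    (γ 0, γb 0) = p ∧ (γ 1, γb 1) = q ∧ IsHorizontalLift γ γb γ' ∧
    L = ∫ t in (0 : ℝ)..1, ‖γ' t‖}

theorem ccLengths_nonneg {p q : Hpt n} {L : ℝ} (hL : L ∈ ccLengths n p q) : 0 ≤ L := by
  obtain ⟨γ, γb, γ', K, -, -, -, -, rfl⟩ := hL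
  exact intervalIntegral.integral_nonneg zero_le_one fun t _ => norm_nonneg _

theorem exists_mem_ccLengths_le (hn : 1 ≤ n) (p q : Hpt n) :
    ∃ L ∈ ccLengths n p (hMul p q), L ≤ 700 * hGauge q := by
  obtain ⟨e, e', he, he', hee'⟩ := exists_omegaForm_eq_one hn
  obtain ⟨a, b, hab, ha, hb⟩ := exists_mul_eq_and_abs_le (-70 * q.2)
  have hs : √|-70 * q.2| ≤ 9 * hGauge q := by
    rw [Real.sqrt_le_left (by have := hGauge_nonneg q; positivity), abs_mul]
    have := abs_snd_le_hGauge_sq q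
    norm_num
    nlinarith [abs_nonneg q.2]
  let α : ℝ → ℝ := fun τ => τ - 3 * τ ^ 2 + 2 * τ ^ 3
  let α' : ℝ → ℝ := fun τ => 1 - 6 * τ + 6 * τ ^ 2
  let β : ℝ → ℝ := fun τ => τ - 6 * τ ^ 2 + 10 * τ ^ 3 - 5 * τ ^ 4
  let β' : ℝ → ℝ := fun τ => 1 - 12 * τ + 30 * τ ^ 2 - 20 * τ ^ 3
  let A : ℝ → ℝ := fun τ => -τ ^ 3 + τ ^ 4
  let B : ℝ → ℝ := fun τ => -2 * τ ^ 3 + 5 * τ ^ 4 - 3 * τ ^ 5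
  let C : ℝ → ℝ := fun τ => -τ ^ 3 + 4 * τ ^ 4 - 33 / 5 * τ ^ 5 + 5 * τ ^ 6 - 10 / 7 * τ ^ 7
  let z : ℝ → Epl n := fun τ => τ • q.1 + (a * α τ) • e + (b * β τ) • e'
  let γ : ℝ → Epl n := fun τ => p.1 + z τ
  let γ' : ℝ → Epl n := fun τ => q.1 + (a * α' τ) • e + (b * β' τ) • e'
  let V : ℝ → ℝ := fun τ => a * A τ * omegaForm q.1 e + b * B τ * omegaForm q.1 e' + a * b * C τ
  let γb : ℝ → ℝ := fun τ => p.2 + (1 / 2) * omegaCLM p.1 (z τ) + (1 / 2) * V τ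
  have hpow : ∀ (k : ℕ) (τ : ℝ), HasDerivAt (fun τ : ℝ => τ ^ k) (k * τ ^ (k - 1)) τ :=
    fun k τ => hasDerivAt_pow k τ
  have hα : ∀ τ, HasDerivAt α (α' τ) τ := fun τ => by
    convert! ((hasDerivAt_id τ).sub ((hpow 2 τ).const_mul 3)).add ((hpow 3 τ).const_mul 2) using 1
    simp only [α']; push_cast; ring
  have hβ : ∀ τ, HasDerivAt β (β' τ) τ := fun τ => by
    convert! (((hasDerivAt_id τ).sub ((hpow 2 τ).const_mul 6)).add
      ((hpow 3 τ).const_mul 10)).sub ((hpow 4 τ).const_mul 5) using 1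
    simp only [β']; push_cast; ring
  have hA : ∀ τ, HasDerivAt A (τ * α' τ - α τ) τ := fun τ => by
    convert! (hpow 3 τ).neg.add (hpow 4 τ) using 1
    simp only [α', α]; push_cast; ring
  have hB : ∀ τ, HasDerivAt B (τ * β' τ - β τ) τ := fun τ => by
    convert! (((hpow 3 τ).const_mul (-2)).add ((hpow 4 τ).const_mul 5)).sub
      ((hpow 5 τ).const_mul 3) using 1
    simp only [β', β]; push_cast; ring
  have hC : ∀ τ, HasDerivAt C (α τ * β' τ - β τ * α' τ) τ := fun τ => by
    convert! ((((hpow 3 τ).neg.add ((hpow 4 τ).const_mul 4)).sub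
      ((hpow 5 τ).const_mul (33 / 5))).add ((hpow 6 τ).const_mul 5)).sub
      ((hpow 7 τ).const_mul (10 / 7)) using 1
    simp only [α', α, β', β]; push_cast; ring
  have hz : ∀ τ, HasDerivAt z (γ' τ) τ := fun τ => by
    convert! (((hasDerivAt_id τ).smul_const q.1).add (((hα τ).const_mul a).smul_const e)).add
      (((hβ τ).const_mul b).smul_const e') using 1
    simp [γ']
  have hγ : ∀ τ, HasDerivAt γ (γ' τ) τ := fun τ => (hz τ).const_add p.1
  have hγb : ∀ τ, HasDerivAt γb ((1 / 2) * omegaForm (γ τ) (γ' τ)) τ := fun τ => by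
    have hV := ((((hA τ).const_mul a).mul_const (omegaForm q.1 e)).add
      (((hB τ).const_mul b).mul_const (omegaForm q.1 e'))).add ((hC τ).const_mul (a * b))
    have hω := ((omegaCLM p.1).hasFDerivAt.comp_hasDerivAt τ (hz τ))
    convert! ((hω.const_mul (1 / 2)).const_add p.2).add (hV.const_mul (1 / 2)) using 1
    simp only [γ, omegaForm_add_left, omegaCLM_apply]
    simp only [γ', z, omegaForm_add_left, omegaForm_add_right, omegaForm_smul_left,
      omegaForm_smul_right, omegaForm_self, omegaForm_swap e q.1, omegaForm_swap e' q.1,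
      omegaForm_swap e' e, hee']
    ring
  have hcd : ContDiff ℝ 1 fun τ => ((γ τ, γb τ) : Hpt n) := by
    have hz' : ContDiff ℝ 1 z := by
      simp only [z, α, β]
      fun_prop
    refine (contDiff_const.add hz').prodMk ?_
    simp only [γb, V, A, B, C]
    fun_prop
  obtain ⟨K, hK⟩ := hcd.contDiffOn.exists_lipschitzOnWith one_ne_zero (convex_Icc (0 : ℝ) 1)
    isCompact_Icc
  refine ⟨∫ t in (0 : ℝ)..1, ‖γ' t‖, ⟨γ, γb, γ', K, hK, ?_, ?_, ?_, rfl⟩, ?_⟩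
  · simp [γ, γb, z, V, α, β, A, B, C]
  · refine Prod.ext (by simp [γ, z, α, β, hMul]; norm_num) ?_
    simp only [γb, z, V, α, β, A, B, C, hMul, hab, omegaCLM_apply, omegaForm_add_right,
      omegaForm_smul_right]
    ring
  · exact ae_of_all _ fun t => ⟨hγ t, hγb t⟩
  · have hbound : ∀ t ∈ Icc (0 : ℝ) 1, ‖γ' t‖ ≤ 700 * hGauge q := fun t ht => by
      have h1 : |α' t| ≤ 13 := by
        rw [abs_le]; constructor <;> simp only [α'] <;> nlinarith [ht.1, ht.2]
      have h2 : |β' t| ≤ 63 := by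
        have h3 : t ^ 3 ≤ 1 := pow_le_one₀ ht.1 ht.2
        have h4 : 0 ≤ t ^ 3 := pow_nonneg ht.1 3
        rw [abs_le]; constructor <;> simp only [β'] <;> nlinarith [ht.1, ht.2]
      have h3 : ‖γ' t‖ ≤ ‖q.1‖ + |a| * |α' t| + |b| * |β' t| := by
        refine (norm_add₃_le).trans (le_of_eq ?_)
        rw [norm_smul, norm_smul, he, he', mul_one, mul_one, Real.norm_eq_abs, Real.norm_eq_abs,
          abs_mul, abs_mul]
      have h4 := norm_fst_le_hGauge q
      have h5 : |a| * |α' t| ≤ 9 * hGauge q * 13 :=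
        mul_le_mul (ha.trans hs) h1 (abs_nonneg _) (by have := hGauge_nonneg q; positivity)
      have h6 : |b| * |β' t| ≤ 9 * hGauge q * 63 :=
        mul_le_mul (hb.trans hs) h2 (abs_nonneg _) (by have := hGauge_nonneg q; positivity)
      have := hGauge_nonneg q
      linarith
    have hcont : Continuous fun t => ‖γ' t‖ := by
      simp only [γ', α', β']
      fun_prop
    have := intervalIntegral.integral_mono_on zero_le_one (hcont.intervalIntegrable 0 1)
      (intervalIntegrable_const (μ := volume)) hbound
    simpa using this

theorem ccDist_le_hDist (hn : 1 ≤ n) (p q : Hpt n) : ccDist n p q ≤ 700 * hDist p q := by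
  obtain ⟨L, hL, hle⟩ := exists_mem_ccLengths_le hn p (hMul (hInv p) q)
  rw [hMul_hInv_cancel_left] at hL
  exact (csInf_le ⟨0, fun _ => ccLengths_nonneg⟩ hL).trans hle

theorem ccDist_nonneg (p q : Hpt n) : 0 ≤ ccDist n p q :=
  Real.sInf_nonneg fun _ => ccLengths_nonneg

theorem abs_sub_le_integral_of_ae_hasDerivAt {φ d m : ℝ → ℝ}
    (hφ : AbsolutelyContinuousOnInterval φ 0 1)
    (hd : ∀ᵐ t ∂(volume.restrict (Icc (0 : ℝ) 1)), HasDerivAt φ (d t) t ∧ |d t| ≤ m t)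
    (hm : IntegrableOn m (Icc 0 1)) (hm0 : ∀ t, 0 ≤ m t) {t : ℝ} (ht : t ∈ Icc (0 : ℝ) 1) :
    |φ t - φ 0| ≤ ∫ s in (0 : ℝ)..1, m s := by
  have hsub : uIcc 0 t ⊆ uIcc (0 : ℝ) 1 := by
    rw [uIcc_of_le ht.1, uIcc_of_le zero_le_one]
    exact Icc_subset_Icc_right ht.2
  have hm' : IntervalIntegrable m volume 0 1 :=
    (intervalIntegrable_iff_integrableOn_Icc_of_le zero_le_one).2 hm
  rw [← (hφ.mono hsub).integral_deriv_eq_sub, ← Real.norm_eq_abs]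
  have h1 : ‖∫ s in (0 : ℝ)..t, deriv φ s‖ ≤ ∫ s in (0 : ℝ)..t, m s := by
    refine intervalIntegral.norm_integral_le_of_norm_le ht.1 ?_ (hm'.mono_set hsub)
    filter_upwards [(ae_restrict_iff' measurableSet_Icc).1 hd] with s hs hst
    have := hs ⟨hst.1.le, hst.2.trans ht.2⟩
    rw [this.1.deriv]
    exact this.2
  refine h1.trans ?_
  exact intervalIntegral.integral_mono_interval le_rfl ht.1 ht.2 (ae_of_all _ hm0) hm'

theorem hDist_le_of_mem_ccLengths {p q : Hpt n} {L : ℝ} (hL : L ∈ ccLengths n p q) :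
    hDist p q ≤ L := by
  have hL0 := ccLengths_nonneg hL
  obtain ⟨γ, γb, γ', K, hK, rfl, rfl, hlift, rfl⟩ := hL
  have hγK : LipschitzOnWith K γ (Icc 0 1) := fun s hs t ht =>
    (by exact le_max_left _ _ : edist (γ s) (γ t) ≤ edist (γ s, γb s) (γ t, γb t)).trans
      (hK hs ht)
  have hγbK : LipschitzOnWith K γb (Icc 0 1) := fun s hs t ht =>
    (by exact le_max_right _ _ : edist (γb s) (γb t) ≤ edist (γ s, γb s) (γ t, γb t)).trans
      (hK hs ht)
  set L := ∫ t in (0 : ℝ)..1, ‖γ' t‖ with hLdef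
  have h_integrable : IntegrableOn (fun t => ‖γ' t‖) (Icc 0 1) := by
    have hmeas : AEStronglyMeasurable γ' (volume.restrict (Icc (0 : ℝ) 1)) :=
      (stronglyMeasurable_deriv γ).aestronglyMeasurable.congr
        (hlift.mono fun t ht => ht.1.deriv)
    refine (Integrable.of_bound hmeas (K : ℝ) ?_).norm
    rw [← restrict_Ioo_eq_restrict_Icc]
    have hlift' := hlift
    rw [IsHorizontalLift, ← restrict_Ioo_eq_restrict_Icc] at hlift'
    filter_upwards [hlift', ae_restrict_mem measurableSet_Ioo] with t ht htI
    exact ht.1.le_of_lipschitzOn (Icc_mem_nhds htI.1 htI.2) hγK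
  have hAC : ∀ x : Epl n →L[ℝ] ℝ, AbsolutelyContinuousOnInterval (fun t => x (γ t)) 0 1 :=
    fun x => (x.lipschitz.comp_lipschitzOnWith
      (by rwa [uIcc_of_le zero_le_one])).absolutelyContinuousOnInterval
  have hhor : ∀ t ∈ Icc (0 : ℝ) 1, ‖γ t - γ 0‖ ≤ L := fun t ht => by
    set u := γ t - γ 0 with hu
    have key := abs_sub_le_integral_of_ae_hasDerivAt (m := fun t => ‖u‖ * ‖γ' t‖)
      (d := fun t => innerSL ℝ u (γ' t)) (hAC (innerSL ℝ u))
      (hlift.mono fun t ht => ⟨(innerSL ℝ u).hasFDerivAt.comp_hasDerivAt t ht.1,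
        by rw [innerSL_apply_apply]; exact abs_real_inner_le_norm _ _⟩)
      (h_integrable.const_mul _) (fun t => by positivity) ht
    rw [← map_sub, ← hu, intervalIntegral.integral_const_mul, innerSL_apply_apply,
      real_inner_self_eq_norm_sq, abs_of_nonneg (by positivity), ← hLdef, sq] at key
    rcases (norm_nonneg u).eq_or_lt with h0 | h0
    · rw [← h0]; exact hL0
    · exact le_of_mul_le_mul_left key h0
  rw [hDist, hGauge_le_iff hL0, hInv_hMul_fst, hInv_hMul_snd]
  refine ⟨hhor 1 (by simp), ?_⟩
  have key := abs_sub_le_integral_of_ae_hasDerivAt (m := fun t => (1 / 2) * L * ‖γ' t‖)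
    (φ := fun t => γb t - (1 / 2) * omegaCLM (γ 0) (γ t))
    (d := fun t => (1 / 2) * omegaForm (γ t) (γ' t) - (1 / 2) * omegaCLM (γ 0) (γ' t))
    ((LipschitzOnWith.absolutelyContinuousOnInterval (by rwa [uIcc_of_le zero_le_one])).sub
      ((hAC (omegaCLM (γ 0))).const_mul (1 / 2)))
    (by
      filter_upwards [hlift, ae_restrict_mem measurableSet_Icc] with t ht htI
      refine ⟨ht.2.sub
        (((omegaCLM (γ 0)).hasFDerivAt.comp_hasDerivAt t ht.1).const_mul (1 / 2)), ?_⟩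
      rw [omegaCLM_apply, ← mul_sub, ← omegaForm_sub_left, abs_mul, mul_assoc,
        abs_of_pos (by norm_num : (0 : ℝ) < 1 / 2)]
      have := (abs_omegaForm_le (γ t - γ 0) (γ' t)).trans
        (mul_le_mul_of_nonneg_right (hhor t htI) (norm_nonneg _))
      linarith)
    (h_integrable.const_mul _) (fun t => by positivity) (right_mem_Icc.2 zero_le_one)
  rw [intervalIntegral.integral_const_mul, ← hLdef] at key
  simp only [omegaCLM_apply, omegaForm_self] at key
  have heq : γb 1 - γb 0 - 1 / 2 * omegaForm (γ 0) (γ 1) =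
      γb 1 - 1 / 2 * omegaForm (γ 0) (γ 1) - (γb 0 - 1 / 2 * 0) := by ring
  simp only [heq]
  nlinarith [sq_nonneg L]

theorem hDist_le_ccDist (hn : 1 ≤ n) (p q : Hpt n) : hDist p q ≤ ccDist n p q := by
  obtain ⟨L, hL, -⟩ := exists_mem_ccLengths_le hn p (hMul (hInv p) q)
  rw [hMul_hInv_cancel_left] at hL
  exact le_csInf ⟨L, hL⟩ fun _ => hDist_le_of_mem_ccLengths

end CarnotCaratheodory

section Measure

variable {n : ℕ}

theorem continuous_hMul : Continuous fun p : Hpt n × Hpt n => hMul p.1 p.2 := by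
  have h : Continuous fun p : Hpt n × Hpt n => omegaForm p.1.1 p.2.1 :=
    continuous_omegaForm.comp (by fun_prop : Continuous fun p : Hpt n × Hpt n => (p.1.1, p.2.1))
  unfold hMul
  fun_prop

theorem continuous_hGauge : Continuous (hGauge : Hpt n → ℝ) := by
  unfold hGauge
  fun_prop

theorem continuous_hor : Continuous (hor : Epl n → Hpt n) := by
  unfold hor
  fun_prop

theorem continuous_hDist_right (p : Hpt n) : Continuous (hDist p) :=
  continuous_hGauge.comp (continuous_hMul.comp (continuous_const.prodMk continuous_id))

theorem measurePreserving_hMul_left (p : Hpt n) :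
    MeasurePreserving (hMul p) (volume : Measure (Hpt n)) volume := by
  rw [Measure.volume_eq_prod]
  refine (measurePreserving_add_left volume p.1).skew_product
    (g := fun x t => p.2 + t + (1 / 2) * omegaForm p.1 x) ?_ ?_
  · exact (continuous_snd.comp (continuous_hMul.comp
      (continuous_const.prodMk continuous_id) : Continuous fun q : Hpt n => hMul p q)).measurable
  · refine ae_of_all _ fun x => ?_
    have h : (fun t => p.2 + t + (1 / 2) * omegaForm p.1 x) =
        fun t => (p.2 + (1 / 2) * omegaForm p.1 x) + t := by
      ext t; ring
    rw [h]
    exact (measurePreserving_add_left volume _).map_eq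

theorem measurePreserving_hMul_right (q : Hpt n) :
    MeasurePreserving (fun p => hMul p q) (volume : Measure (Hpt n)) volume := by
  rw [Measure.volume_eq_prod]
  refine (measurePreserving_add_right volume q.1).skew_product
    (g := fun x t => t + q.2 + (1 / 2) * omegaForm x q.1) ?_ ?_
  · exact (continuous_snd.comp (continuous_hMul.comp
      (continuous_id.prodMk continuous_const) : Continuous fun p : Hpt n => hMul p q)).measurable
  · refine ae_of_all _ fun x => ?_
    simp only [add_assoc]
    exact (measurePreserving_add_right volume _).map_eq

/-- The closed ball of `hDist`. -/
def hBall (p : Hpt n) (r : ℝ) : Set (Hpt n) := {q | hDist q p ≤ r}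

theorem mem_hBall {p q : Hpt n} {r : ℝ} : q ∈ hBall p r ↔ hDist q p ≤ r := Iff.rfl

theorem measurableSet_hBall (p : Hpt n) (r : ℝ) : MeasurableSet (hBall p r) := by
  have : hBall p r = {q | hDist p q ≤ r} := by
    ext q
    rw [mem_hBall, hDist_comm]
    rfl
  rw [this]
  exact (isClosed_le (continuous_hDist_right p) continuous_const).measurableSet

theorem volume_hBall_zero {r : ℝ} (hr : 0 ≤ r) :
    volume (hBall (0 : Hpt n) r) = ENNReal.ofReal (r ^ (2 * n + 2)) *
      (volume (Metric.closedBall (0 : Epl n) 1) * volume (Metric.closedBall (0 : ℝ) 1)) := by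
  have h : hBall (0 : Hpt n) r =
      Metric.closedBall (0 : Epl n) r ×ˢ Metric.closedBall (0 : ℝ) (r ^ 2) := by
    ext q
    rw [mem_hBall, hDist_comm, hDist, hGauge_le_iff hr]
    simp [hMul, hInv]
  rw [h, Measure.volume_eq_prod, Measure.prod_prod, Measure.addHaar_closedBall' _ _ hr,
    Measure.addHaar_closedBall' _ _ (sq_nonneg r), finrank_euclideanSpace_fin,
    Module.finrank_self, pow_one, pow_add, ENNReal.ofReal_mul (by positivity)]
  ring

theorem volume_hBall (p : Hpt n) {r : ℝ} (hr : 0 ≤ r) :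
    volume (hBall p r) = ENNReal.ofReal (r ^ (2 * n + 2)) * volume (hBall (0 : Hpt n) 1) := by
  have h : hBall p r = hMul (hInv p) ⁻¹' hBall 0 r := by
    ext q
    rw [mem_preimage, mem_hBall, mem_hBall, ← hDist_hMul_left (hInv p) q p, hInv_hMul_self]
  rw [h, (measurePreserving_hMul_left _).measure_preimage
    (measurableSet_hBall _ _).nullMeasurableSet, volume_hBall_zero hr,
    volume_hBall_zero zero_le_one]
  simp

theorem volume_hBall_one_ne_top : volume (hBall (0 : Hpt n) 1) ≠ ⊤ := by
  rw [volume_hBall_zero zero_le_one]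
  exact ENNReal.mul_ne_top ENNReal.ofReal_ne_top
    (ENNReal.mul_ne_top measure_closedBall_lt_top.ne measure_closedBall_lt_top.ne)

theorem volume_hBall_one_ne_zero : volume (hBall (0 : Hpt n) 1) ≠ 0 := by
  rw [volume_hBall_zero zero_le_one]
  refine mul_ne_zero (by simp) (mul_ne_zero ?_ ?_)
  all_goals exact (Metric.measure_closedBall_pos _ _ zero_lt_one).ne'

theorem volume_hBall_ne_top (p : Hpt n) {r : ℝ} (hr : 0 ≤ r) : volume (hBall p r) ≠ ⊤ := by
  rw [volume_hBall p hr]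
  exact ENNReal.mul_ne_top ENNReal.ofReal_ne_top volume_hBall_one_ne_top

theorem isOpen_iff_hDist (s : Set (Hpt n)) :
    IsOpen s ↔ ∀ p ∈ s, ∃ ε > 0, ∀ q, hDist p q < ε → q ∈ s := by
  constructor
  · intro hs p hp
    obtain ⟨r, hr, hrs⟩ := Metric.isOpen_iff.1 hs p hp
    obtain ⟨ε, hε, hεr⟩ : ∃ ε > 0, ε ^ 2 + (1 / 2) * (‖p.1‖ * ε) + ε < r := by
      have hlim : Tendsto (fun ε : ℝ => ε ^ 2 + (1 / 2) * (‖p.1‖ * ε) + ε) (𝓝[>] 0) (𝓝 0) := by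
        refine Tendsto.mono_left (Continuous.tendsto' ?_ _ _ (by simp)) nhdsWithin_le_nhds
        fun_prop
      obtain ⟨ε, h1, h2⟩ := ((hlim.eventually_lt_const hr).and self_mem_nhdsWithin).exists
      exact ⟨ε, h2, h1⟩
    refine ⟨ε, hε, fun q hq => hrs ?_⟩
    have h1 := norm_fst_sub_le_hDist p q
    have h2 := abs_snd_sub_le_hDist_sq p q
    have h0 : 0 ≤ hDist p q := hGauge_nonneg _
    have h3 : |omegaForm p.1 q.1| ≤ ‖p.1‖ * ε := by
      have : omegaForm p.1 q.1 = omegaForm p.1 (q.1 - p.1) := by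
        rw [omegaForm_sub_right, omegaForm_self, sub_zero]
      rw [this]
      exact (abs_omegaForm_le _ _).trans
        (mul_le_mul_of_nonneg_left (h1.trans hq.le) (norm_nonneg _))
    have h4 : |q.2 - p.2| ≤ ε ^ 2 + (1 / 2) * (‖p.1‖ * ε) := by
      have h5 : hDist p q ^ 2 ≤ ε ^ 2 := pow_le_pow_left₀ h0 hq.le 2
      rw [abs_le] at h2 h3 ⊢
      constructor <;> linarith
    rw [Metric.mem_ball, Prod.dist_eq, max_lt_iff, dist_eq_norm, Real.dist_eq]
    have : 0 ≤ ‖p.1‖ * ε := by positivity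
    constructor <;> nlinarith
  · intro h
    rw [isOpen_iff_mem_nhds]
    intro p hp
    obtain ⟨ε, hε, hs⟩ := h p hp
    have : Tendsto (hDist p) (𝓝 p) (𝓝 0) :=
      (continuous_hDist_right p).tendsto' _ _ (hDist_self p)
    exact mem_of_superset (this.eventually_lt_const hε) hs

/-- The Heisenberg group as a metric space for the distance `hDist`. -/
def HeisSpace (n : ℕ) := Hpt n

instance : PseudoMetricSpace (HeisSpace n) :=
  PseudoMetricSpace.ofDistTopology (α := Hpt n) hDist hDist_self hDist_comm hDist_triangle
    isOpen_iff_hDist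

instance : MeasurableSpace (HeisSpace n) := inferInstanceAs (MeasurableSpace (Hpt n))

instance : BorelSpace (HeisSpace n) := inferInstanceAs (BorelSpace (Hpt n))

instance : SecondCountableTopology (HeisSpace n) :=
  inferInstanceAs (SecondCountableTopology (Hpt n))

/-- Lebesgue measure on `HeisSpace n`. -/
def heisVolume (n : ℕ) : Measure (HeisSpace n) := (volume : Measure (Hpt n))

instance : IsLocallyFiniteMeasure (heisVolume n) :=
  inferInstanceAs (IsLocallyFiniteMeasure (volume : Measure (Hpt n)))

instance : IsUnifLocDoublingMeasure (heisVolume n) where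
  exists_measure_closedBall_le_mul'' := by
    refine ⟨2 ^ (2 * n + 2), ?_⟩
    filter_upwards [self_mem_nhdsWithin] with ε (hε : 0 < ε) p
    refine ((volume_hBall p (by positivity)).trans ?_).le
    refine Eq.trans ?_ (congrArg _ (volume_hBall p hε.le).symm)
    rw [mul_pow, ENNReal.ofReal_mul (by positivity), mul_assoc,
      ENNReal.ofReal_pow zero_le_two]
    simp

/-- The Lebesgue differentiation theorem on `hDist`-balls. -/
theorem ae_eventually_setLIntegral_hBall_le {g : Hpt n → ℝ} (hg : Measurable g) {M : ℝ}
    (hM : ∀ p, |g p| ≤ M) :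
    ∀ᵐ p ∂(volume : Measure (Hpt n)), ∀ η > 0, ∀ᶠ ε in 𝓝[>] (0 : ℝ),
      ∫⁻ q in hBall p ε, ‖g q - g p‖ₑ ≤ ENNReal.ofReal η * volume (hBall p ε) := by
  have hloc : LocallyIntegrable (X := HeisSpace n) g (heisVolume n) := by
    refine (locallyIntegrable_const M).mono (hg.aestronglyMeasurable) (ae_of_all _ fun p => ?_)
    exact (hM p).trans (le_abs_self M)
  have h := IsUnifLocDoublingMeasure.ae_tendsto_average_norm_sub
    (heisVolume n) hloc 1
  filter_upwards [h] with p hp η hη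
  have hlim := hp (l := 𝓝[>] (0 : ℝ)) (fun _ => p) id tendsto_id (by
    filter_upwards [self_mem_nhdsWithin] with ε (hε : 0 < ε)
    exact Metric.mem_closedBall_self (by simpa using hε.le))
  filter_upwards [hlim.eventually_lt_const hη, self_mem_nhdsWithin] with ε hε (hε0 : 0 < ε)
  have hfin := volume_hBall_ne_top p hε0.le
  have hpos : volume (hBall p ε) ≠ 0 := by
    rw [volume_hBall p hε0.le]
    exact mul_ne_zero (by simpa using pow_pos hε0 _) volume_hBall_one_ne_zero
  have h_integrable : IntegrableOn (fun q => g q - g p) (hBall p ε) volume :=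
    Measure.integrableOn_of_bounded (M := M + M) hfin (hg.sub_const _).aestronglyMeasurable
      (ae_of_all _ fun q => (norm_sub_le _ _).trans (add_le_add (hM q) (hM p)))
  have hε' : ⨍ q in hBall p ε, ‖g q - g p‖ < η := hε
  rw [setAverage_eq, smul_eq_mul, measureReal_def,
    inv_mul_lt_iff₀ (ENNReal.toReal_pos hpos hfin)] at hε'
  rw [← ofReal_integral_norm_eq_lintegral_enorm h_integrable]
  refine (ENNReal.ofReal_le_ofReal hε'.le).trans (le_of_eq ?_)
  rw [ENNReal.ofReal_mul ENNReal.toReal_nonneg, ENNReal.ofReal_toReal hfin, mul_comm]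

end Measure

section Horizontal

variable {n : ℕ}

/-- Derivative of `F` at `p` along the horizontal line of direction `v`. -/
def horDeriv (F : Hpt n → ℝ) (v : Epl n) (p : Hpt n) : ℝ :=
  deriv (fun s : ℝ => F (hMul p (hor (s • v)))) 0

theorem deriv_hMul_hor (F : Hpt n → ℝ) (v : Epl n) (p : Hpt n) (s : ℝ) :
    deriv (fun s : ℝ => F (hMul p (hor (s • v)))) s = horDeriv F v (hMul p (hor (s • v))) := by
  simp only [horDeriv, hMul_hor_hMul_hor]
  rw [deriv_comp_const_add (fun s => F (hMul p (hor (s • v)))), add_zero]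

theorem hDist_hMul_hor (p : Hpt n) (v : Epl n) (s t : ℝ) :
    hDist (hMul p (hor (s • v))) (hMul p (hor (t • v))) = |t - s| * ‖v‖ := by
  have h : t = s + (t - s) := by ring
  rw [hDist_hMul_left, h, ← hor_hMul_hor_smul, hDist_self_hMul, hGauge_hor, norm_smul,
    Real.norm_eq_abs, ← h]

variable {F : Hpt n → ℝ} {K : ℝ}

theorem continuous_of_abs_sub_le_hDist (hF : ∀ p q, |F p - F q| ≤ K * hDist p q) :
    Continuous F := by
  rw [continuous_iff_continuousAt]
  intro p
  rw [ContinuousAt, tendsto_iff_dist_tendsto_zero]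
  have h : Tendsto (fun q => K * hDist p q) (𝓝 p) (𝓝 0) :=
    (continuous_const.mul (continuous_hDist_right p)).tendsto' _ _ (by simp)
  refine squeeze_zero (fun _ => dist_nonneg) (fun q => ?_) h
  rw [dist_comm, Real.dist_eq]
  exact hF p q

theorem lipschitzWith_hMul_hor (hK : 0 ≤ K) (hF : ∀ p q, |F p - F q| ≤ K * hDist p q)
    (v : Epl n) (p : Hpt n) :
    LipschitzWith (K * ‖v‖).toNNReal fun s : ℝ => F (hMul p (hor (s • v))) := by
  refine LipschitzWith.of_dist_le_mul fun s t => ?_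
  rw [Real.coe_toNNReal _ (by positivity), Real.dist_eq, Real.dist_eq]
  refine (hF _ _).trans (le_of_eq ?_)
  rw [hDist_hMul_hor, abs_sub_comm]
  ring

theorem measurable_horDeriv (hF : Continuous F) (v : Epl n) : Measurable (horDeriv F v) := by
  have hc : Continuous (Function.uncurry fun (p : Hpt n) (s : ℝ) => F (hMul p (hor (s • v)))) :=
    hF.comp (continuous_hMul.comp
      (continuous_fst.prodMk (continuous_hor.comp (continuous_snd.smul continuous_const))))
  exact (measurable_deriv_with_param hc).comp measurable_prodMk_right

theorem abs_horDeriv_le (hK : 0 ≤ K) (hF : ∀ p q, |F p - F q| ≤ K * hDist p q) (v : Epl n)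
    (p : Hpt n) : |horDeriv F v p| ≤ K * ‖v‖ := by
  have := norm_deriv_le_of_lipschitz (lipschitzWith_hMul_hor hK hF v p) (x₀ := 0)
  rwa [Real.coe_toNNReal _ (by positivity)] at this

theorem enorm_sub_sub_le_lintegral (hK : 0 ≤ K) (hF : ∀ p q, |F p - F q| ≤ K * hDist p q)
    (v : Epl n) (q : Hpt n) (c : ℝ) {s S : ℝ} (hs : |s| ≤ S) :
    ‖F (hMul q (hor (s • v))) - F q - s * c‖ₑ ≤
      ∫⁻ τ in Icc (-S) S, ‖horDeriv F v (hMul q (hor (τ • v))) - c‖ₑ := by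
  have hAC : AbsolutelyContinuousOnInterval (fun s : ℝ => F (hMul q (hor (s • v)))) 0 s :=
    ((lipschitzWith_hMul_hor hK hF v q).lipschitzOnWith).absolutelyContinuousOnInterval
  have hftc := hAC.integral_deriv_eq_sub
  have h_integrable := hAC.intervalIntegrable_deriv
  simp only [funext (deriv_hMul_hor F v q)] at hftc h_integrable
  have h1 : F (hMul q (hor (s • v))) - F q - s * c =
      ∫ τ in (0 : ℝ)..s, (horDeriv F v (hMul q (hor (τ • v))) - c) := by
    rw [intervalIntegral.integral_sub h_integrable intervalIntegrable_const, hftc]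
    simp [hor, Prod.mk_zero_zero]
  have h2 : uIoc 0 s ⊆ Icc (-S) S := by
    obtain ⟨h3, h4⟩ := abs_le.1 hs
    intro τ hτ
    rcases mem_uIoc.1 hτ with h | h <;> constructor <;> linarith [h.1, h.2]
  rw [h1, intervalIntegral.intervalIntegral_eq_integral_uIoc]
  split_ifs
  · rw [one_smul]
    exact (enorm_integral_le_lintegral_enorm _).trans (lintegral_mono_set h2)
  · rw [neg_one_smul, enorm_neg]
    exact (enorm_integral_le_lintegral_enorm _).trans (lintegral_mono_set h2)

theorem setLIntegral_enorm_sub_sub_le (hK : 0 ≤ K) (hF : ∀ p q, |F p - F q| ≤ K * hDist p q)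
    {v : Epl n} (hv : ‖v‖ = 1) (p q₀ : Hpt n) (c : ℝ) {s S r r' : ℝ} (hs : |s| ≤ S)
    (hr : hDist p q₀ + r + S ≤ r') :
    ∫⁻ q in hBall q₀ r, ‖F (hMul q (hor (s • v))) - F q - s * c‖ₑ ≤
      ENNReal.ofReal (2 * S) * ∫⁻ q in hBall p r', ‖horDeriv F v q - c‖ₑ := by
  have hmeas := measurable_horDeriv (continuous_of_abs_sub_le_hDist hF) v
  have hG : Measurable fun q => ‖horDeriv F v q - c‖ₑ := (hmeas.sub_const c).enorm
  have hflow : Measurable fun z : Hpt n × ℝ => hMul z.1 (hor (z.2 • v)) :=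
    (continuous_hMul.comp (continuous_fst.prodMk
      (continuous_hor.comp (continuous_snd.smul continuous_const)))).measurable
  calc ∫⁻ q in hBall q₀ r, ‖F (hMul q (hor (s • v))) - F q - s * c‖ₑ
      ≤ ∫⁻ q in hBall q₀ r, ∫⁻ τ in Icc (-S) S,
          ‖horDeriv F v (hMul q (hor (τ • v))) - c‖ₑ :=
        lintegral_mono fun q => enorm_sub_sub_le_lintegral hK hF v q c hs
    _ = ∫⁻ τ in Icc (-S) S, ∫⁻ q in hBall q₀ r,
          ‖horDeriv F v (hMul q (hor (τ • v))) - c‖ₑ :=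
        lintegral_lintegral_swap (hG.comp hflow).aemeasurable
    _ ≤ ∫⁻ τ in Icc (-S) S, ∫⁻ q in hBall p r', ‖horDeriv F v q - c‖ₑ := by
        refine setLIntegral_mono measurable_const fun τ hτ => ?_
        rw [← (measurePreserving_hMul_right (hor (τ • v))).setLIntegral_comp_preimage
          (measurableSet_hBall p r') hG]
        refine lintegral_mono_set fun q hq => ?_
        rw [mem_preimage, mem_hBall]
        rw [mem_hBall] at hq
        have h1 := hDist_triangle (hMul q (hor (τ • v))) q p
        have h2 := hDist_triangle q q₀ p
        have h3 : hDist (hMul q (hor (τ • v))) q = |τ| := by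
          rw [hDist_comm, hDist_self_hMul, hGauge_hor, norm_smul, hv, mul_one, Real.norm_eq_abs]
        have h4 : |τ| ≤ S := abs_le.2 ⟨hτ.1, hτ.2⟩
        rw [hDist_comm q₀ p] at h2
        linarith
    _ = _ := by
        rw [setLIntegral_const, Real.volume_Icc, mul_comm]
        congr 2
        ring

theorem hDist_hMul_hor_right_le {p q : Hpt n} {v : Epl n} {ρ R κ : ℝ} (hκ : 0 ≤ κ)
    (hv : ‖v‖ ≤ R) (h : hDist p q ≤ ρ) (hρκ : ρ ≤ κ) (hρ : ρ * (ρ + R) ≤ κ ^ 2) :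
    hDist (hMul p (hor v)) (hMul q (hor v)) ≤ κ := by
  have h0 : 0 ≤ hDist p q := hGauge_nonneg _
  have h1 := norm_fst_sub_le_hDist p q
  have h2 := abs_snd_sub_le_hDist_sq p q
  rw [hDist, hGauge_le_iff hκ, hInv_hMul_fst, hInv_hMul_snd]
  simp only [hMul_hor]
  refine ⟨by rw [add_sub_add_right_eq_sub]; linarith, ?_⟩
  have h3 : |omegaForm (q.1 - p.1) v| ≤ ρ * R :=
    (abs_omegaForm_le _ _).trans
      (mul_le_mul (h1.trans h) hv (norm_nonneg _) (h0.trans h))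
  have h4 : q.2 + 1 / 2 * omegaForm q.1 v - (p.2 + 1 / 2 * omegaForm p.1 v)
      - 1 / 2 * omegaForm (p.1 + v) (q.1 + v) =
      (q.2 - p.2 - 1 / 2 * omegaForm p.1 q.1) + omegaForm (q.1 - p.1) v := by
    simp only [omegaForm_add_left, omegaForm_add_right, omegaForm_sub_left, omegaForm_self,
      omegaForm_swap v q.1]
    ring
  rw [h4]
  refine (abs_add_le _ _).trans ?_
  have h5 : hDist p q ^ 2 ≤ ρ ^ 2 := pow_le_pow_left₀ h0 h 2
  nlinarith

/-- At a Lebesgue point of the derivative along `v`, increments along `v` are asymptotically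
linear, uniformly in the base point. -/
theorem eventually_abs_sub_sub_le (hK : 0 ≤ K) (hF : ∀ p q, |F p - F q| ≤ K * hDist p q)
    {v : Epl n} (hv : ‖v‖ = 1) {p : Hpt n} {c : ℝ}
    (hp : ∀ η > 0, ∀ᶠ ε in 𝓝[>] (0 : ℝ),
      ∫⁻ q in hBall p ε, ‖horDeriv F v q - c‖ₑ ≤ ENNReal.ofReal η * volume (hBall p ε))
    {R δ : ℝ} (hR : 0 < R) (hδ : 0 < δ) :
    ∀ᶠ ε in 𝓝[>] (0 : ℝ), ∀ q₀, hDist p q₀ ≤ R * ε → ∀ s : ℝ, |s| ≤ R * ε →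
      |F (hMul q₀ (hor (s • v))) - F q₀ - s * c| ≤ δ * ε := by
  set κ := δ / (3 * (K + 1)) with hκdef
  have hκ : 0 < κ := by positivity
  have hKκ : K * κ ≤ δ / 3 := by
    rw [hκdef, mul_div_assoc', div_le_div_iff₀ (by positivity) (by positivity)]
    nlinarith
  set ρ := κ ^ 2 / (κ + R) with hρdef
  have hρ : 0 < ρ := by positivity
  have hρκ : ρ ≤ κ := by
    rw [hρdef, div_le_iff₀ (by positivity)]
    nlinarith
  have hρR : ρ * (ρ + R) ≤ κ ^ 2 := by
    have : ρ * (κ + R) = κ ^ 2 := div_mul_cancel₀ _ (by positivity)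
    nlinarith
  set T := 2 * R + ρ with hTdef
  have hT : 0 < T := by positivity
  set Q := 2 * n + 2
  set η := δ / 3 * ρ ^ Q / (2 * R * T ^ Q + 1) with hηdef
  have hη : 0 < η := by positivity
  have hηlt : 2 * R * (η * T ^ Q) < δ / 3 * ρ ^ Q := by
    have h1 : η * (2 * R * T ^ Q + 1) = δ / 3 * ρ ^ Q := div_mul_cancel₀ _ (by positivity)
    linarith
  have hscale : Tendsto (fun ε : ℝ => T * ε) (𝓝[>] 0) (𝓝[>] 0) := by
    refine tendsto_nhdsWithin_iff.2 ⟨?_, ?_⟩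
    · exact ((continuous_const.mul continuous_id).tendsto' _ _ (by simp)).mono_left
        nhdsWithin_le_nhds
    · filter_upwards [self_mem_nhdsWithin] with ε (hε : 0 < ε)
      exact mul_pos hT hε
  filter_upwards [hscale.eventually (hp η hη), self_mem_nhdsWithin] with ε hε (hε0 : 0 < ε)
    q₀ hq₀ s hs
  obtain ⟨q, hq, hle⟩ : ∃ q ∈ hBall q₀ (ρ * ε),
      |F (hMul q (hor (s • v))) - F q - s * c| ≤ δ / 3 * ε := by
    by_contra! hcon
    have hlow : ENNReal.ofReal (δ / 3 * ε) * volume (hBall q₀ (ρ * ε)) ≤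
        ∫⁻ q in hBall q₀ (ρ * ε), ‖F (hMul q (hor (s • v))) - F q - s * c‖ₑ := by
      rw [← setLIntegral_const]
      refine setLIntegral_mono' (measurableSet_hBall _ _) fun q hq => ?_
      rw [Real.enorm_eq_ofReal_abs]
      exact ENNReal.ofReal_le_ofReal (hcon q hq).le
    have hup := hlow.trans (setLIntegral_enorm_sub_sub_le hK hF hv p q₀ c hs
      (r' := T * ε) (by rw [hTdef]; linarith))
    have hup' := hup.trans (mul_le_mul_right hε _)
    rw [volume_hBall q₀ (by positivity), volume_hBall p (by positivity), ← mul_assoc, ← mul_assoc,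
      ← mul_assoc, ENNReal.mul_le_mul_iff_left volume_hBall_one_ne_zero volume_hBall_one_ne_top,
      ← ENNReal.ofReal_mul (by positivity), ← ENNReal.ofReal_mul (by positivity),
      ← ENNReal.ofReal_mul (by positivity), ENNReal.ofReal_le_ofReal_iff (by positivity),
      mul_pow, mul_pow] at hup'
    have hpos : 0 < ε * ε ^ Q := by positivity
    have := mul_lt_mul_of_pos_right hηlt hpos
    linarith
  rw [mem_hBall] at hq
  have h1 := hF q q₀
  have h2 := hF (hMul q (hor (s • v))) (hMul q₀ (hor (s • v)))
  have hq' : hDist q q₀ ≤ ρ * ε := hq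
  have h3 : hDist (hMul q (hor (s • v))) (hMul q₀ (hor (s • v))) ≤ κ * ε :=
    hDist_hMul_hor_right_le (R := R * ε) (by positivity) (by rwa [norm_smul, hv, mul_one]) hq'
      (mul_le_mul_of_nonneg_right hρκ hε0.le)
      (by nlinarith [mul_le_mul_of_nonneg_right hρR (sq_nonneg ε)])
  have h4 : K * hDist q q₀ ≤ δ / 3 * ε :=
    (mul_le_mul_of_nonneg_left (hq'.trans (mul_le_mul_of_nonneg_right hρκ hε0.le)) hK).trans
      (by nlinarith)
  have h5 : K * hDist (hMul q (hor (s • v))) (hMul q₀ (hor (s • v))) ≤ δ / 3 * ε :=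
    (mul_le_mul_of_nonneg_left h3 hK).trans (by nlinarith)
  rw [abs_le] at *
  constructor <;> linarith [h1.1, h1.2, h2.1, h2.2, hle.1, hle.2]

end Horizontal

section Increments

variable {n : ℕ}

theorem hor_smul_commutator {e e' : Epl n} (h : omegaForm e e' = 1) (s t : ℝ) :
    hMul (hMul (hMul (hor (s • e)) (hor (t • e'))) (hor ((-s) • e))) (hor ((-t) • e')) =
      (0, s * t) := by
  have h' : omegaForm e' e = -1 := by rw [omegaForm_swap, h]
  refine Prod.ext ?_ ?_
  · simp only [hMul, hor, neg_smul]
    abel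
  · simp only [hMul, hor, omegaForm_add_left, omegaForm_smul_left, omegaForm_smul_right,
      omegaForm_self, h, h']
    ring

/-- The increments of `F` near `p` in the directions of the family `A` are asymptotically given
by `ℓ`, where `A r` consists of group elements of size at most a multiple of `r`. -/
def HasIncrements (F : Hpt n → ℝ) (p : Hpt n) (ℓ : Epl n →L[ℝ] ℝ) (A : ℝ → Set (Hpt n)) : Prop :=
  (∃ C > 0, ∀ r > 0, ∀ a ∈ A r, hGauge a ≤ C * r) ∧
  ∀ R > 0, ∀ S > 0, ∀ δ > 0, ∀ᶠ ε in 𝓝[>] (0 : ℝ), ∀ q, hDist p q ≤ R * ε →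
    ∀ a ∈ A (S * ε), |F (hMul q a) - F q - ℓ a.1| ≤ δ * ε

variable {F : Hpt n → ℝ} {p : Hpt n} {ℓ : Epl n →L[ℝ] ℝ} {A B : ℝ → Set (Hpt n)}

theorem HasIncrements.mono (h : HasIncrements F p ℓ A) {c : ℝ} (hc : 0 < c)
    (hBA : ∀ r > 0, B r ⊆ A (c * r)) : HasIncrements F p ℓ B := by
  obtain ⟨⟨C, hC, hA⟩, hinc⟩ := h
  refine ⟨⟨C * c, by positivity, fun r hr a ha => ?_⟩, fun R hR S hS δ hδ => ?_⟩
  · rw [mul_assoc]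
    exact hA _ (by positivity) a (hBA r hr ha)
  · filter_upwards [hinc R hR (c * S) (by positivity) δ hδ, self_mem_nhdsWithin]
      with ε hε (hε0 : 0 < ε) q hq a ha
    refine hε q hq a ?_
    rw [mul_assoc]
    exact hBA _ (by positivity) ha

theorem HasIncrements.mul (hA : HasIncrements F p ℓ A) (hB : HasIncrements F p ℓ B) :
    HasIncrements F p ℓ fun r => image2 hMul (A r) (B r) := by
  obtain ⟨⟨C, hC, hAC⟩, hAi⟩ := hA
  obtain ⟨⟨D, hD, hBD⟩, hBi⟩ := hB
  refine ⟨⟨C + D, by positivity, ?_⟩, fun R hR S hS δ hδ => ?_⟩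
  · rintro r hr _ ⟨a, ha, b, hb, rfl⟩
    rw [add_mul]
    exact (hGauge_hMul_le a b).trans (add_le_add (hAC r hr a ha) (hBD r hr b hb))
  · filter_upwards [hAi R hR S hS (δ / 2) (by positivity),
      hBi (R + C * S) (by positivity) S hS (δ / 2) (by positivity), self_mem_nhdsWithin]
      with ε hε₁ hε₂ (hε0 : 0 < ε) q hq
    rintro _ ⟨a, ha, b, hb, rfl⟩
    have h1 := hε₁ q hq a ha
    have h2 := hε₂ (hMul q a) ?_ b hb
    · have h3 : (hMul a b).1 = a.1 + b.1 := rfl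
      rw [← hMul_assoc, h3, map_add]
      rw [abs_le] at *
      constructor <;> linarith [h1.1, h1.2, h2.1, h2.2]
    · have h4 := hDist_triangle p q (hMul q a)
      have h5 := hAC _ (by positivity) a ha
      rw [hDist_self_hMul] at h4
      linarith

/-- The horizontal segment of half-length `r` in the `i`-th coordinate direction. -/
def horSegment (i : Fin (2 * n)) (r : ℝ) : Set (Hpt n) :=
  {a | ∃ s : ℝ, |s| ≤ r ∧ a = hor (s • EuclideanSpace.single i 1)}

theorem hasIncrements_vertical (hn : 1 ≤ n) (h : ∀ i, HasIncrements F p ℓ (horSegment i)) :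
    HasIncrements F p ℓ fun r => {a | hGauge a ≤ r ∧ a.1 = 0} := by
  obtain ⟨i, j, hij⟩ := exists_omegaForm_single_eq_one hn
  refine (((h i).mul (h j)).mul (h i)).mul (h j) |>.mono one_pos fun r hr => ?_
  rintro ⟨v, u⟩ ⟨ha, hv⟩
  obtain ⟨s, t, hst, hs, ht⟩ := exists_mul_eq_and_abs_le u
  have hu : √|u| ≤ 1 * r := by
    rw [one_mul]
    exact (le_max_right _ _).trans ha
  refine ⟨_, ⟨_, ⟨_, ⟨s, hs.trans hu, rfl⟩, _, ⟨t, ht.trans hu, rfl⟩, rfl⟩, _,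
    ⟨-s, by rw [abs_neg]; exact hs.trans hu, rfl⟩, rfl⟩, _,
    ⟨-t, by rw [abs_neg]; exact ht.trans hu, rfl⟩, ?_⟩
  rw [hor_smul_commutator hij, hst, ← hv]

theorem hasIncrements_of_horSegment (hn : 1 ≤ n) (h : ∀ i, HasIncrements F p ℓ (horSegment i)) :
    HasIncrements F p ℓ fun r => {a | hGauge a ≤ r} := by
  suffices H : ∀ S : Finset (Fin (2 * n)),
      HasIncrements F p ℓ fun r => {a | hGauge a ≤ r ∧ ∀ i ∉ S, a.1 i = 0} from
    (H Finset.univ).mono one_pos fun r _ a (ha : hGauge a ≤ r) =>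
      ⟨by rwa [one_mul], fun i hi => absurd (Finset.mem_univ i) hi⟩
  intro S
  induction S using Finset.induction_on with
  | empty =>
    refine (hasIncrements_vertical hn h).mono one_pos fun r _ a ha => ?_
    refine ⟨by rw [one_mul]; exact ha.1, ?_⟩
    ext i
    exact ha.2 i (Finset.notMem_empty i)
  | insert i S _ ih =>
    refine (ih.mul (h i)).mono two_pos fun r hr a ha => ?_
    have hai : |a.1 i| ≤ r :=
      (PiLp.norm_apply_le a.1 i).trans ((norm_fst_le_hGauge a).trans ha.1)
    refine ⟨hMul a (hor ((-a.1 i) • EuclideanSpace.single i 1)), ⟨?_, fun j hj => ?_⟩,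
      _, ⟨a.1 i, by linarith, rfl⟩, ?_⟩
    · refine (hGauge_hMul_le _ _).trans ?_
      rw [hGauge_hor, norm_smul, PiLp.norm_single, norm_one, mul_one, norm_neg,
        Real.norm_eq_abs]
      have := ha.1
      linarith
    · rw [hMul_hor]
      by_cases hji : j = i
      · subst hji
        simp
      · have := ha.2 j (by simp [hji, hj])
        simp [this, hji]
    · rw [hMul_hor_hMul_hor, neg_add_cancel, zero_smul]
      exact hMul_zero a

theorem ae_exists_hasIncrements (hn : 1 ≤ n) {K : ℝ} (hK : 0 ≤ K)
    (hF : ∀ p q, |F p - F q| ≤ K * hDist p q) :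
    ∀ᵐ p, ∃ ℓ : Epl n →L[ℝ] ℝ, HasIncrements F p ℓ fun r => {a | hGauge a ≤ r} := by
  have hleb : ∀ᵐ p, ∀ i : Fin (2 * n), ∀ η > 0, ∀ᶠ ε in 𝓝[>] (0 : ℝ),
      ∫⁻ q in hBall p ε, ‖horDeriv F (EuclideanSpace.single i 1) q -
        horDeriv F (EuclideanSpace.single i 1) p‖ₑ ≤ ENNReal.ofReal η * volume (hBall p ε) :=
    ae_all_iff.2 fun i => ae_eventually_setLIntegral_hBall_le
      (measurable_horDeriv (continuous_of_abs_sub_le_hDist hF) _)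
      fun q => abs_horDeriv_le hK hF _ q
  filter_upwards [hleb] with p hp
  refine ⟨∑ i, horDeriv F (EuclideanSpace.single i 1) p • EuclideanSpace.proj i,
    hasIncrements_of_horSegment hn fun i => ⟨⟨1, one_pos, ?_⟩, fun R hR S hS δ hδ => ?_⟩⟩
  · rintro r - _ ⟨s, hs, rfl⟩
    rwa [hGauge_hor, norm_smul, PiLp.norm_single, norm_one, mul_one, one_mul,
      Real.norm_eq_abs]
  · filter_upwards [eventually_abs_sub_sub_le hK hF (by simp) (hp i) (R := max R S)
      (lt_max_of_lt_left hR) hδ, self_mem_nhdsWithin] with ε hε (hε0 : 0 < ε) q hq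
    rintro _ ⟨s, hs, rfl⟩
    have h := hε q (hq.trans (mul_le_mul_of_nonneg_right (le_max_left _ _) hε0.le)) s
      (hs.trans (mul_le_mul_of_nonneg_right (le_max_right _ _) hε0.le))
    convert h using 3
    simp [hor, PiLp.single_apply, mul_comm]

end Increments

section Blowup

variable {n : ℕ}

theorem abs_omegaForm_sub_omegaForm_le {a b a' b' : Epl n} {M η : ℝ} (ha : ‖a - a'‖ ≤ η)
    (hb : ‖b - b'‖ ≤ η) (ha' : ‖a'‖ ≤ M) (hb' : ‖b'‖ ≤ M) :
    |omegaForm a b - omegaForm a' b'| ≤ η * (2 * M + η) := by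
  have h0 : 0 ≤ η := (norm_nonneg _).trans ha
  have h1 : omegaForm a b - omegaForm a' b' =
      omegaForm (a - a') (b - b') + omegaForm (a - a') b' + omegaForm a' (b - b') := by
    simp only [omegaForm_sub_left, omegaForm_sub_right]
    ring
  rw [h1]
  have h2 := (abs_omegaForm_le (a - a') (b - b')).trans
    (mul_le_mul ha hb (norm_nonneg _) h0)
  have h3 := (abs_omegaForm_le (a - a') b').trans (mul_le_mul ha hb' (norm_nonneg _) h0)
  have h4 := (abs_omegaForm_le a' (b - b')).trans
    (mul_le_mul ha' hb (norm_nonneg _) ((norm_nonneg _).trans ha'))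
  exact (abs_add_three _ _ _).trans (by linarith)

/-- The vertical component of a Lipschitz map along a horizontal segment is controlled by the
horizontal component, through a subdivision of the segment into `m` pieces. -/
theorem abs_snd_hMul_hor_sub_le {g : Hpt n → Hpt n} {L : Epl n →L[ℝ] Epl n} {K R η : ℝ}
    (hK : 0 ≤ K) (hg : ∀ p q, hDist (g p) (g q) ≤ K * hDist p q)
    (hL : ∀ q, hGauge q ≤ 2 * R → ‖(g q).1 - L q.1‖ ≤ η) {m : ℕ} (hm : 0 < m) {q : Hpt n}
    {v : Epl n} (hq : hGauge q ≤ R) (hv : ‖v‖ ≤ R) :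
    |(g (hMul q (hor v))).2 - (g q).2 - (1 / 2) * omegaForm (L q.1) (L v)| ≤
      (K * R) ^ 2 / m + m * ((1 / 2) * (η * (4 * ‖L‖ * R + η))) := by
  have hm' : (0 : ℝ) < m := by exact_mod_cast hm
  set τ : ℝ := (m : ℝ)⁻¹ with hτ
  have hτ0 : 0 < τ := by positivity
  have hmτ : m * τ = 1 := mul_inv_cancel₀ hm'.ne'
  have hR : 0 ≤ R := (norm_nonneg v).trans hv
  set c : ℝ := (K * (τ * R)) ^ 2 + (1 / 2) * (η * (4 * ‖L‖ * R + η)) with hc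
  let w : ℕ → Hpt n := fun k => hMul q (hor (((k : ℝ) * τ) • v))
  have hw : ∀ k, k ≤ m → hGauge (w k) ≤ 2 * R := fun k hk => by
    have hkm : (k : ℝ) ≤ m := by exact_mod_cast hk
    have h1 : (k : ℝ) * τ ≤ 1 := by
      rw [← hmτ]
      exact mul_le_mul_of_nonneg_right hkm hτ0.le
    refine (hGauge_hMul_le _ _).trans ?_
    rw [hGauge_hor, norm_smul, Real.norm_of_nonneg (by positivity)]
    have := mul_le_mul h1 hv (norm_nonneg _) zero_le_one
    linarith
  have key : ∀ k : ℕ, k ≤ m →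
      |(g (w k)).2 - (g q).2 - k * τ * ((1 / 2) * omegaForm (L q.1) (L v))| ≤ k * c := by
    intro k
    induction k with
    | zero =>
      intro _
      have : w 0 = q := by
        simp only [w, Nat.cast_zero, zero_mul, zero_smul]
        exact hMul_zero q
      simp [this]
    | succ k ih =>
      intro hk
      have h1 := ih (by omega)
      have h2 := abs_snd_sub_le_hDist_sq (g (w k)) (g (w (k + 1)))
      have h3 : hDist (g (w k)) (g (w (k + 1))) ≤ K * (τ * R) := by
        refine (hg _ _).trans (mul_le_mul_of_nonneg_left ?_ hK)
        rw [hDist_hMul_hor]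
        push_cast
        rw [add_mul, one_mul, add_sub_cancel_left, abs_of_pos hτ0]
        exact mul_le_mul_of_nonneg_left hv hτ0.le
      have h4 := pow_le_pow_left₀ (hGauge_nonneg _) h3 2
      have hM : ∀ j, j ≤ m → ‖L (w j).1‖ ≤ ‖L‖ * (2 * R) := fun j hj =>
        (L.le_opNorm _).trans (mul_le_mul_of_nonneg_left
          ((norm_fst_le_hGauge _).trans (hw j hj)) (norm_nonneg _))
      have h5 := abs_omegaForm_sub_omegaForm_le (hL _ (hw k (by omega))) (hL _ (hw _ hk))
        (hM k (by omega)) (hM _ hk)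
      have h6 : omegaForm (L (w k).1) (L (w (k + 1)).1) = τ * omegaForm (L q.1) (L v) := by
        simp only [w, hMul_hor, map_add, map_smul, omegaForm_add_left, omegaForm_add_right,
          omegaForm_smul_left, omegaForm_smul_right, omegaForm_self, omegaForm_swap (L v) (L q.1)]
        push_cast
        ring
      rw [h6] at h5
      have h7 : hDist (g (w k)) (g (w (k + 1))) ^ 2 ≤ (K * (τ * R)) ^ 2 := h4
      push_cast
      rw [abs_le] at *
      constructor <;> linarith [h1.1, h1.2, h2.1, h2.2, h5.1, h5.2]
  have hfin := key m le_rfl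
  have hwm : w m = hMul q (hor v) := by simp only [w, hmτ, one_smul]
  rw [hmτ, one_mul, hwm] at hfin
  refine hfin.trans (le_of_eq ?_)
  rw [hc, hτ]
  field_simp

variable {ι : Type*} {l : Filter ι} {g : ι → Hpt n → Hpt n} {L : Epl n →L[ℝ] Epl n} {K : ℝ}

theorem eventually_abs_snd_hMul_hor_sub_le (hK : 0 ≤ K)
    (hg : ∀ᶠ i in l, ∀ p q, hDist (g i p) (g i q) ≤ K * hDist p q)
    (hL : ∀ R > 0, ∀ δ > 0, ∀ᶠ i in l, ∀ q, hGauge q ≤ R → ‖(g i q).1 - L q.1‖ ≤ δ)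
    {R δ : ℝ} (hR : 0 < R) (hδ : 0 < δ) :
    ∀ᶠ i in l, ∀ q, hGauge q ≤ R → ∀ v, ‖v‖ ≤ R →
      |(g i (hMul q (hor v))).2 - (g i q).2 - (1 / 2) * omegaForm (L q.1) (L v)| ≤ δ := by
  obtain ⟨m, hm⟩ := exists_nat_gt ((K * R) ^ 2 / (δ / 2))
  have hm0 : (0 : ℝ) < m := lt_of_le_of_lt (by positivity) hm
  have hm1 : (K * R) ^ 2 / m ≤ δ / 2 := by
    rw [div_lt_iff₀ (by positivity)] at hm
    rw [div_le_iff₀ hm0]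
    linarith
  set D := m * (4 * ‖L‖ * R + 1) with hD
  have hD0 : 0 < D := by positivity
  set η := min 1 (δ / D) with hη
  have hη0 : 0 < η := by positivity
  have hη1 : η ≤ 1 := min_le_left _ _
  have hηD : η * D ≤ δ := (le_div_iff₀ hD0).1 (min_le_right _ _)
  filter_upwards [hg, hL (2 * R) (by positivity) η hη0] with i hgi hLi q hq v hv
  refine (abs_snd_hMul_hor_sub_le hK hgi hLi (by exact_mod_cast hm0) hq hv).trans ?_
  have h1 : m * (η * (4 * ‖L‖ * R + η)) ≤ η * D := by
    rw [hD, mul_left_comm]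
    gcongr
  linarith

theorem eventually_abs_snd_sub_le (hK : 0 ≤ K)
    (hg : ∀ᶠ i in l, ∀ p q, hDist (g i p) (g i q) ≤ K * hDist p q) (hg0 : ∀ i, g i 0 = 0)
    (hL : ∀ R > 0, ∀ δ > 0, ∀ᶠ i in l, ∀ q, hGauge q ≤ R → ‖(g i q).1 - L q.1‖ ≤ δ)
    {e e' : Epl n} (he : ‖e‖ = 1) (he' : ‖e'‖ = 1) (hee' : omegaForm e e' = 1)
    {R δ : ℝ} (hR : 0 < R) (hδ : 0 < δ) :
    ∀ᶠ i in l, ∀ q, hGauge q ≤ R → |(g i q).2 - omegaForm (L e) (L e') * q.2| ≤ δ := by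
  filter_upwards [eventually_abs_snd_hMul_hor_sub_le hK hg hL (R := 5 * R) (δ := δ / 5)
    (by positivity) (by positivity)] with i hi q hq
  obtain ⟨s, t, hst, hs, ht⟩ := exists_mul_eq_and_abs_le q.2
  have hsR : |s| ≤ R := hs.trans ((le_max_right _ _).trans hq)
  have htR : |t| ≤ R := ht.trans ((le_max_right _ _).trans hq)
  have hx : ‖q.1‖ ≤ R := (norm_fst_le_hGauge q).trans hq
  have hse : ‖s • e‖ ≤ R := by rwa [norm_smul, he, mul_one]
  have hte : ‖t • e'‖ ≤ R := by rwa [norm_smul, he', mul_one]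
  have hse' : ‖(-s) • e‖ ≤ R := by rwa [neg_smul, norm_neg]
  have hte' : ‖(-t) • e'‖ ≤ R := by rwa [neg_smul, norm_neg]
  have hstep : ∀ (p : Hpt n) (v : Epl n) (r : ℝ), hGauge p ≤ r → ‖v‖ ≤ R →
      hGauge (hMul p (hor v)) ≤ r + R := fun p v r hp hv => by
    refine (hGauge_hMul_le _ _).trans ?_
    rw [hGauge_hor]
    exact add_le_add hp hv
  set q₁ := hor q.1 with hq₁
  set q₂ := hMul q₁ (hor (s • e)) with hq₂
  set q₃ := hMul q₂ (hor (t • e')) with hq₃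
  set q₄ := hMul q₃ (hor ((-s) • e)) with hq₄
  have g₁ : hGauge q₁ ≤ R := by rwa [hq₁, hGauge_hor]
  have g₂ := hstep _ _ _ g₁ hse
  have g₃ := hstep _ _ _ g₂ hte
  have g₄ := hstep _ _ _ g₃ hse'
  have hq₅ : hMul q₄ (hor ((-t) • e')) = q := by
    rw [hq₄, hq₃, hq₂, hMul_assoc, hMul_assoc, hMul_assoc, ← hMul_assoc (hor (t • e')),
      ← hMul_assoc (hor (s • e)), ← hMul_assoc (hor (s • e)), hor_smul_commutator hee', hst]
    simp [hMul, hq₁, hor]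
  have h₁ := hi 0 (by rw [hGauge_zero]; positivity) q.1 (by linarith)
  have h₂ := hi q₁ (by linarith) (s • e) (by linarith)
  have h₃ := hi q₂ (by linarith) (t • e') (by linarith)
  have h₄ := hi q₃ (by linarith) ((-s) • e) (by linarith)
  have h₅ := hi q₄ (by linarith) ((-t) • e') (by linarith)
  rw [hq₅] at h₅
  rw [zero_hMul, ← hq₁, hg0] at h₁
  rw [← hq₂] at h₂
  rw [← hq₃] at h₃
  rw [← hq₄] at h₄
  have hsum : (1 / 2) * omegaForm (L q₁.1) (L (s • e)) + (1 / 2) * omegaForm (L q₂.1) (L (t • e'))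
      + (1 / 2) * omegaForm (L q₃.1) (L ((-s) • e))
      + (1 / 2) * omegaForm (L q₄.1) (L ((-t) • e')) = omegaForm (L e) (L e') * q.2 := by
    simp only [hq₄, hq₃, hq₂, hMul_hor, map_add, map_smul, omegaForm_add_left,
      omegaForm_smul_left, omegaForm_smul_right, omegaForm_self, omegaForm_swap (L e') (L e),
      ← hst]
    ring
  simp only [Prod.fst_zero, Prod.snd_zero, map_zero, omegaForm_zero_left] at h₁
  rw [← hsum]
  rw [abs_le] at *
  constructor <;> linarith [h₁.1, h₁.2, h₂.1, h₂.2, h₃.1, h₃.2, h₄.1, h₄.2, h₅.1, h₅.2]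

theorem omegaForm_map_map [l.NeBot] (hK : 0 ≤ K)
    (hg : ∀ᶠ i in l, ∀ p q, hDist (g i p) (g i q) ≤ K * hDist p q) (hg0 : ∀ i, g i 0 = 0)
    (hL : ∀ R > 0, ∀ δ > 0, ∀ᶠ i in l, ∀ q, hGauge q ≤ R → ‖(g i q).1 - L q.1‖ ≤ δ)
    {e e' : Epl n} (he : ‖e‖ = 1) (he' : ‖e'‖ = 1) (hee' : omegaForm e e' = 1) (x y : Epl n) :
    omegaForm (L x) (L y) = omegaForm (L e) (L e') * omegaForm x y := by
  rw [← sub_eq_zero, ← abs_nonpos_iff]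
  refine le_of_forall_pos_le_add fun δ hδ => ?_
  set R := ‖x‖ + ‖y‖ + 1 with hR
  have hx := norm_nonneg x
  have hy := norm_nonneg y
  obtain ⟨i, h₁, h₂⟩ := ((eventually_abs_snd_hMul_hor_sub_le hK hg hL (R := R) (δ := δ / 6)
    (by positivity) (by positivity)).and (eventually_abs_snd_sub_le hK hg hg0 hL he he' hee'
      (R := R) (δ := δ / 6) (by positivity) (by positivity))).exists
  have h₃ := h₁ (hor x) (by rw [hGauge_hor]; linarith) y (by linarith)
  have h₄ := h₂ (hor x) (by rw [hGauge_hor]; linarith)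
  have h₅ := h₂ (hMul (hor x) (hor y)) ((hGauge_hMul_le _ _).trans (by
    rw [hGauge_hor, hGauge_hor]; linarith))
  have h₆ : (hMul (hor x) (hor y)).2 = (1 / 2) * omegaForm x y := by simp [hMul, hor]
  rw [h₆] at h₅
  simp only [hor, mul_zero, sub_zero] at h₃ h₄ h₅
  rw [abs_le] at *
  constructor <;> linarith [h₃.1, h₃.2, h₄.1, h₄.2, h₅.1, h₅.2]

theorem isPansuLinear_of_omegaForm_map {c : ℝ}
    (h : ∀ x y, omegaForm (L x) (L y) = c * omegaForm x y) :
    IsPansuLinear n fun q => (L q.1, c * q.2) := by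
  refine ⟨fun p q => Prod.ext ?_ ?_, fun ε _ p => Prod.ext ?_ ?_⟩
  · simp [hMul]
  · simp only [hMul, h]
    ring
  · simp [hDil]
  · simp only [hDil]
    ring

theorem hDist_le_of_norm_sub_le {p q : Hpt n} {M η δ : ℝ} (hq : ‖q.1‖ ≤ M) (hδ : 0 ≤ δ)
    (hηδ : η ≤ δ) (h : η * (1 + M) ≤ δ ^ 2) (h₁ : ‖p.1 - q.1‖ ≤ η) (h₂ : |p.2 - q.2| ≤ η) :
    hDist p q ≤ δ := by
  have hη : 0 ≤ η := (norm_nonneg _).trans h₁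
  rw [hDist_comm, hDist, hGauge_le_iff hδ, hInv_hMul_fst, hInv_hMul_snd]
  refine ⟨h₁.trans hηδ, ?_⟩
  have h₃ : |omegaForm q.1 p.1| ≤ M * η := by
    have : omegaForm q.1 p.1 = omegaForm q.1 (p.1 - q.1) := by
      rw [omegaForm_sub_right, omegaForm_self, sub_zero]
    rw [this]
    exact (abs_omegaForm_le _ _).trans
      (mul_le_mul hq h₁ (norm_nonneg _) ((norm_nonneg _).trans hq))
  have hM : 0 ≤ M * η := mul_nonneg ((norm_nonneg _).trans hq) hη
  rw [abs_le] at *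
  constructor <;> linarith [h₂.1, h₂.2, h₃.1, h₃.2]

/-- A family of equi-Lipschitz maps fixing the origin whose horizontal components converge
locally uniformly to a linear map converges locally uniformly to a Pansu linear map. -/
theorem exists_isPansuLinear_eventually_hDist_le (hn : 1 ≤ n) [l.NeBot] (hK : 0 ≤ K)
    (hg : ∀ᶠ i in l, ∀ p q, hDist (g i p) (g i q) ≤ K * hDist p q) (hg0 : ∀ i, g i 0 = 0)
    (hL : ∀ R > 0, ∀ δ > 0, ∀ᶠ i in l, ∀ q, hGauge q ≤ R → ‖(g i q).1 - L q.1‖ ≤ δ) :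
    ∃ D : Hpt n → Hpt n, IsPansuLinear n D ∧
      ∀ R > 0, ∀ δ > 0, ∀ᶠ i in l, ∀ q, hGauge q ≤ R → hDist (g i q) (D q) ≤ δ := by
  obtain ⟨e, e', he, he', hee'⟩ := exists_omegaForm_eq_one hn
  refine ⟨_, isPansuLinear_of_omegaForm_map (omegaForm_map_map hK hg hg0 hL he he' hee'),
    fun R hR δ hδ => ?_⟩
  set M := ‖L‖ * R with hM
  have hM0 : 0 ≤ M := by positivity
  set η := min δ (δ ^ 2 / (1 + M)) with hη
  have hη0 : 0 < η := by positivity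
  filter_upwards [hL R hR η hη0,
    eventually_abs_snd_sub_le hK hg hg0 hL he he' hee' hR hη0] with i h₁ h₂ q hq
  refine hDist_le_of_norm_sub_le (M := M) ?_ hδ.le (min_le_left _ _)
    ((le_div_iff₀ (by positivity)).1 (min_le_right _ _)) (h₁ q hq) (h₂ q hq)
  exact (L.le_opNorm _).trans
    (mul_le_mul_of_nonneg_left ((norm_fst_le_hGauge _).trans hq) (norm_nonneg _))

end Blowup

section PansuRademacher

variable {n : ℕ}

/-- The rescaled increment `δ_ε⁻¹ (f(p)⁻¹ · f(p · δ_ε q))`. -/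
def pansuQuotient (f : Hpt n → Hpt n) (p : Hpt n) (ε : ℝ) (q : Hpt n) : Hpt n :=
  hDil ε⁻¹ (hMul (hInv (f p)) (f (hMul p (hDil ε q))))

theorem hDist_pansuQuotient_le {f : Hpt n → Hpt n} {K : ℝ}
    (hf : ∀ p q, hDist (f p) (f q) ≤ K * hDist p q) (p : Hpt n) {ε : ℝ} (hε : 0 < ε)
    (q q' : Hpt n) :
    hDist (pansuQuotient f p ε q) (pansuQuotient f p ε q') ≤ K * hDist q q' := by
  rw [pansuQuotient, pansuQuotient, hDist_hDil (inv_nonneg.2 hε.le), hDist_hMul_left,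
    inv_mul_le_iff₀ hε]
  refine (hf _ _).trans (le_of_eq ?_)
  rw [hDist_hMul_left, hDist_hDil hε.le]
  ring

theorem pansuQuotient_fst (f : Hpt n → Hpt n) (p : Hpt n) (ε : ℝ) (q : Hpt n) :
    (pansuQuotient f p ε q).1 = ε⁻¹ • ((f (hMul p (hDil ε q))).1 - (f p).1) := by
  rw [pansuQuotient, ← hInv_hMul_fst]
  rfl

theorem norm_le_of_forall_abs_le {m : ℕ} {x : EuclideanSpace ℝ (Fin m)} {δ : ℝ}
    (h : ∀ i, |x i| ≤ δ / (m + 1)) (hδ : 0 ≤ δ) : ‖x‖ ≤ δ := by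
  have h1 : ‖x‖ ≤ ∑ i, |x i| := by
    conv_lhs => rw [← (EuclideanSpace.basisFun (Fin m) ℝ).sum_repr x]
    refine (norm_sum_le _ _).trans (le_of_eq ?_)
    simp [norm_smul]
  refine h1.trans ((Finset.sum_le_sum fun i _ => h i).trans ?_)
  rw [Finset.sum_const, Finset.card_univ, Fintype.card_fin, nsmul_eq_mul, mul_div_assoc',
    div_le_iff₀ (by positivity)]
  nlinarith

/-- The horizontal components of the Pansu difference quotients of a Lipschitz map converge
almost everywhere. -/
theorem ae_exists_eventually_norm_fst_sub_le (hn : 1 ≤ n) {f : Hpt n → Hpt n} {K : ℝ} (hK : 0 ≤ K)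
    (hf : ∀ p q, hDist (f p) (f q) ≤ K * hDist p q) :
    ∀ᵐ p, ∃ L : Epl n →L[ℝ] Epl n, ∀ R > 0, ∀ δ > 0, ∀ᶠ ε in 𝓝[>] (0 : ℝ), ∀ q,
      hGauge q ≤ R → ‖(pansuQuotient f p ε q).1 - L q.1‖ ≤ δ := by
  have hcoord : ∀ k p q, |(f p).1 k - (f q).1 k| ≤ K * hDist p q := fun k p q => by
    have h1 := norm_fst_sub_le_hDist (f q) (f p)
    rw [hDist_comm] at h1
    exact (PiLp.norm_apply_le ((f p).1 - (f q).1) k).trans (h1.trans (hf p q))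
  filter_upwards [ae_all_iff.2 fun k => ae_exists_hasIncrements hn hK (hcoord k)] with p hp
  choose ℓ hℓ using hp
  refine ⟨(EuclideanSpace.equiv (Fin (2 * n)) ℝ).symm.toContinuousLinearMap ∘L
    ContinuousLinearMap.pi ℓ, fun R hR δ hδ => ?_⟩
  have hev := eventually_all.2 fun k => (hℓ k).2 1 one_pos R hR (δ / ((2 * n : ℕ) + 1))
    (by positivity)
  filter_upwards [hev, self_mem_nhdsWithin] with ε hε (hε0 : 0 < ε) q hq
  refine norm_le_of_forall_abs_le (fun k => ?_) hδ.le
  have h1 := hε k p (by rw [hDist_self]; positivity) (hDil ε q) (by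
    rw [hGauge_hDil hε0.le, mul_comm]
    exact mul_le_mul_of_nonneg_right hq hε0.le)
  have h2 : (hDil ε q).1 = ε • q.1 := rfl
  rw [h2, map_smul, smul_eq_mul] at h1
  rw [pansuQuotient_fst]
  have h3 : (ε⁻¹ • ((f (hMul p (hDil ε q))).1 - (f p).1) -
      ((EuclideanSpace.equiv (Fin (2 * n)) ℝ).symm.toContinuousLinearMap ∘L
        ContinuousLinearMap.pi ℓ) q.1) k =
      ε⁻¹ * ((f (hMul p (hDil ε q))).1 k - (f p).1 k - ε * ℓ k q.1) := by
    rw [mul_sub, inv_mul_cancel_left₀ hε0.ne']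
    rfl
  rw [h3, abs_mul, abs_of_pos (inv_pos.2 hε0), inv_mul_le_iff₀ hε0, mul_comm ε (δ / _)]
  exact h1

end PansuRademacher

/-- Pansu–Rademacher theorem for the Heisenberg group: a map `f : H(n) → H(n)`
which is Lipschitz for the Carnot–Carathéodory distance is Pansu differentiable
at almost every point (with respect to Lebesgue measure on `ℝ^{2n+1}`). -/
theorem pansu_rademacher (n : ℕ) (hn : 1 ≤ n) (f : Hpt n → Hpt n) (K : ℝ)
    (hf : ∀ p q : Hpt n, ccDist n (f p) (f q) ≤ K * ccDist n p q) :
    ∀ᵐ p ∂(volume : Measure (Hpt n)), PansuDifferentiableAt n f p := by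
  have hK : 0 ≤ |K| * 700 := by positivity
  have hf' : ∀ p q, hDist (f p) (f q) ≤ |K| * 700 * hDist p q := fun p q => by
    refine (hDist_le_ccDist hn _ _).trans ((hf p q).trans ?_)
    rw [mul_assoc]
    exact mul_le_mul (le_abs_self K) (ccDist_le_hDist hn p q) (ccDist_nonneg _ _) (abs_nonneg K)
  filter_upwards [ae_exists_eventually_norm_fst_sub_le hn hK hf'] with p ⟨L, hL⟩
  have hg : ∀ᶠ ε in 𝓝[>] (0 : ℝ), ∀ q q',
      hDist (pansuQuotient f p ε q) (pansuQuotient f p ε q') ≤ |K| * 700 * hDist q q' := by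
    filter_upwards [self_mem_nhdsWithin] with ε (hε : 0 < ε)
    exact hDist_pansuQuotient_le hf' p hε
  obtain ⟨D, hD, hlim⟩ := exists_isPansuLinear_eventually_hDist_le hn hK hg
    (fun ε => by simp [pansuQuotient, hDil_apply_zero]) hL
  refine ⟨D, hD, fun δ hδ => ?_⟩
  obtain ⟨ε₀, hε₀, hsub⟩ := mem_nhdsGT_iff_exists_Ioo_subset.1
    (hlim 1 one_pos (δ / 700) (by positivity))
  refine ⟨ε₀, hε₀, fun ε h1 h2 q hq => (ccDist_le_hDist hn _ _).trans ?_⟩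
  have hq' : hGauge q ≤ 1 := by
    have := (hDist_le_ccDist hn (0, 0) q).trans hq
    rwa [Prod.mk_zero_zero, ← zero_hMul q, hDist_self_hMul] at this
  have := hsub ⟨h1, h2⟩ q hq'
  rw [le_div_iff₀ (by norm_num), mul_comm] at this
  exact this
end
end
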